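/- Let n ≥ 1, 0 < ε ≤ 1, 0 ≤ ρ ≤ 1 and 1 ≤ p < ∞. Let ω : [0,∞) → [0,∞) be non-decreasing and bounded with ∫₀¹ ω(t) t⁻¹ dt < ∞. Let σ : 𝕋ⁿ × ℤⁿ → ℂ be a symbol, smooth in x, for which there is C > 0 such that |∂_x^β Δ_ξ^α σ(x,ξ)| ≤ C ω(⟨ξ⟩^{−ε}) ⟨ξ⟩^{−(n/2)(1−ρ) − ρ|α|} for all (x,ξ) ∈ 𝕋ⁿ × ℤⁿ and all multi-indices α, β ∈ ℕⁿ with |α| ≤ [n/2]+1 and |β| ≤ [n/p]+1. Then the periodic pseudo-differential operator σ(x,D) extends to a bounded operator on L^p(𝕋ⁿ). -/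

import Mathlib

open MeasureTheory Real ENNReal

noncomputable section

/-- Partial derivative of a complex-valued function on `ℝⁿ` in the `j`-th coordinate
direction. -/
def pd {n : ℕ} (j : Fin n) (f : (Fin n → ℝ) → ℂ) : (Fin n → ℝ) → ℂ :=
  fun x => fderiv ℝ f x (Pi.single j 1)

/-- The canonical list of directions associated to a multi-index `β ∈ ℕⁿ`. -/
def mIdxList {n : ℕ} (β : Fin n → ℕ) : List (Fin n) :=
  (List.finRange n).flatMap fun j => List.replicate (β j) j

/-- Iterated partial derivative `∂^β` associated to a multi-index `β`. -/
def pdM {n : ℕ} (β : Fin n → ℕ) (f : (Fin n → ℝ) → ℂ) : (Fin n → ℝ) → ℂ :=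
  (mIdxList β).foldr pd f

/-- Forward difference operator in the `j`-th direction on functions of `ξ ∈ ℤⁿ`. -/
def dd {n : ℕ} (j : Fin n) (g : (Fin n → ℤ) → ℂ) : (Fin n → ℤ) → ℂ :=
  fun ξ => g (ξ + Pi.single j 1) - g ξ

/-- Iterated difference operator `Δ_ξ^α` associated to a multi-index `α`. -/
def ddM {n : ℕ} (α : Fin n → ℕ) (g : (Fin n → ℤ) → ℂ) : (Fin n → ℤ) → ℂ :=
  (mIdxList α).foldr dd g

/-- Japanese bracket `⟨ξ⟩ = (1+|ξ|²)^{1/2}` of a lattice point `ξ ∈ ℤⁿ`. -/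
def jb {n : ℕ} (ξ : Fin n → ℤ) : ℝ := Real.sqrt (1 + ∑ j, ((ξ j : ℝ)) ^ 2)

/-- Japanese bracket `⟨ξ⟩ = (1+|ξ|²)^{1/2}` of a vector `ξ ∈ ℝⁿ`. -/
def jbR {n : ℕ} (ξ : Fin n → ℝ) : ℝ := Real.sqrt (1 + ∑ j, (ξ j) ^ 2)

/-- The canonical embedding `ℤⁿ → ℝⁿ`. -/
def castZ {n : ℕ} (ξ : Fin n → ℤ) : Fin n → ℝ := fun j => (ξ j : ℝ)

/-- The fundamental domain `[0,1)ⁿ` of the torus `𝕋ⁿ = ℝⁿ/ℤⁿ`. -/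
def cube (n : ℕ) : Set (Fin n → ℝ) := Set.univ.pi fun _ => Set.Ico (0 : ℝ) 1

/-- The normalized Lebesgue measure of the torus `𝕋ⁿ`, realized as the Lebesgue measure
on `ℝⁿ` restricted to the fundamental domain `[0,1)ⁿ`. -/
def μT (n : ℕ) : Measure (Fin n → ℝ) := volume.restrict (cube n)

/-- `1`-periodicity of a function on `ℝⁿ` (i.e. the function descends to `𝕋ⁿ`). -/
def Per {n : ℕ} (f : (Fin n → ℝ) → ℂ) : Prop :=
  ∀ (x : Fin n → ℝ) (v : Fin n → ℤ), f (x + fun j => (v j : ℝ)) = f x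

/-- The character `e^{2πi⟨x,ξ⟩}`. -/
def eChar {n : ℕ} (x : Fin n → ℝ) (ξ : Fin n → ℤ) : ℂ :=
  Complex.exp (2 * (π : ℂ) * Complex.I * ∑ j, (x j : ℂ) * (ξ j : ℂ))

/-- Fourier coefficient `f̂(ξ) = ∫_{𝕋ⁿ} e^{-2πi⟨x,ξ⟩} f(x) dx` of a function on `𝕋ⁿ`. -/
def fc {n : ℕ} (f : (Fin n → ℝ) → ℂ) (ξ : Fin n → ℤ) : ℂ :=
  ∫ x, Complex.exp (-(2 * (π : ℂ) * Complex.I) * ∑ j, (x j : ℂ) * (ξ j : ℂ)) * f x ∂(μT n)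

/-- Periodic pseudo-differential operator
    `σ(x,D)f(x) = Σ_{ξ ∈ ℤⁿ} e^{2πi⟨x,ξ⟩} σ(x,ξ) f̂(ξ)`
with symbol `σ` on `𝕋ⁿ × ℤⁿ`. -/
def Op {n : ℕ} (σ : (Fin n → ℝ) → (Fin n → ℤ) → ℂ) (f : (Fin n → ℝ) → ℂ) :
    (Fin n → ℝ) → ℂ :=
  fun x => ∑' ξ : Fin n → ℤ, eChar x ξ * σ x ξ * fc f ξ

/-- The `L^p(𝕋ⁿ)` norm, for a real exponent `p`. -/
def lpT (n : ℕ) (p : ℝ) (g : (Fin n → ℝ) → ℂ) : ℝ :=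
  (∫ x, ‖g x‖ ^ p ∂(μT n)) ^ (1 / p)

/-- `∂_x^β Δ_ξ^α σ(x,ξ)` for a symbol `σ` on `𝕋ⁿ × ℤⁿ` (difference operator applied first,
then the derivatives in `x`). -/
def symbDxD {n : ℕ} (β α : Fin n → ℕ) (σ : (Fin n → ℝ) → (Fin n → ℤ) → ℂ)
    (x : Fin n → ℝ) (ξ : Fin n → ℤ) : ℂ :=
  pdM β (fun x' => ddM α (σ x') ξ) x

/-- `Δ_ξ^α ∂_x^β σ(x,ξ)` for a symbol `σ` on `𝕋ⁿ × ℤⁿ` (derivatives in `x` applied first,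
then the difference operator in `ξ`). -/
def symbDDx {n : ℕ} (α β : Fin n → ℕ) (σ : (Fin n → ℝ) → (Fin n → ℤ) → ℂ)
    (x : Fin n → ℝ) (ξ : Fin n → ℤ) : ℂ :=
  ddM α (fun ξ' => pdM β (fun x' => σ x' ξ') x) ξ

/-- `∂_ξ^α ∂_x^β σ(x,ξ)` for a symbol `σ` on `𝕋ⁿ × ℝⁿ` (derivatives in `x` applied first,
then the derivatives in `ξ`). -/
def symbDξDx {n : ℕ} (α β : Fin n → ℕ) (σ : (Fin n → ℝ) → (Fin n → ℝ) → ℂ)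
    (x ξ : Fin n → ℝ) : ℂ :=
  pdM α (fun ξ' => pdM β (fun x' => σ x' ξ') x) ξ

/-- `∂_x^β ∂_ξ^α σ(x,ξ)` for a symbol `σ` on `𝕋ⁿ × ℝⁿ` (derivatives in `ξ` applied first,
then the derivatives in `x`). -/
def symbDxDξ {n : ℕ} (β α : Fin n → ℕ) (σ : (Fin n → ℝ) → (Fin n → ℝ) → ℂ)
    (x ξ : Fin n → ℝ) : ℂ :=
  pdM β (fun x' => pdM α (σ x') ξ) x

/-- The Euclidean Fourier transform `û(ξ) = ∫_{ℝⁿ} e^{-2πi⟨x,ξ⟩} u(x) dx`. -/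
def FT {n : ℕ} (u : (Fin n → ℝ) → ℂ) (ξ : Fin n → ℝ) : ℂ :=
  ∫ x, Complex.exp (-(2 * (π : ℂ) * Complex.I) * ∑ j, (x j : ℂ) * (ξ j : ℂ)) * u x

/-- Pseudo-differential operator on `ℝⁿ`:
`T_σ u(x) = ∫_{ℝⁿ} e^{2πi⟨x,ξ⟩} σ(x,ξ) û(ξ) dξ`. -/
def OpR {n : ℕ} (σ : (Fin n → ℝ) → (Fin n → ℝ) → ℂ) (u : (Fin n → ℝ) → ℂ) :
    (Fin n → ℝ) → ℂ :=
  fun x => ∫ ξ, Complex.exp (2 * (π : ℂ) * Complex.I * ∑ j, (x j : ℂ) * (ξ j : ℂ)) * σ x ξ * FT u ξ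

/-- Periodic amplitude operator
`a(x,y,D)u(x) = ∫_{𝕋ⁿ} ∫_{ℝⁿ} e^{2πi⟨x-y,ξ⟩} a(x,y,ξ) u(y) dξ dy`. -/
def OpAmp {n : ℕ} (a : (Fin n → ℝ) → (Fin n → ℝ) → (Fin n → ℝ) → ℂ)
    (u : (Fin n → ℝ) → ℂ) : (Fin n → ℝ) → ℂ :=
  fun x => ∫ y,
    (∫ ξ, Complex.exp (2 * (π : ℂ) * Complex.I * ∑ j, ((x j : ℂ) - (y j : ℂ)) * (ξ j : ℂ)) *
        a x y ξ) * u y ∂(μT n)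

/-- The `L^p(ℝⁿ)` norm, for a real exponent `p`. -/
def lpR (n : ℕ) (p : ℝ) (g : (Fin n → ℝ) → ℂ) : ℝ :=
  (∫ x, ‖g x‖ ^ p) ^ (1 / p)

/-! ### Periodic integration over the cube -/

lemma cube_eq_fundamentalDomain (n : ℕ) :
    cube n = ZSpan.fundamentalDomain (Pi.basisFun ℝ (Fin n)) :=
  ZSpan.fundamentalDomain_pi_basisFun.symm

lemma measurableSet_cube (n : ℕ) : MeasurableSet (cube n) :=
  MeasurableSet.univ_pi fun _ => measurableSet_Ico

lemma μT_eq_pi (n : ℕ) :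
    μT n = Measure.pi fun _ : Fin n => (volume : Measure ℝ).restrict (Set.Ico 0 1) := by
  rw [μT, volume_pi, cube, Measure.restrict_pi_pi]

instance isProbabilityMeasure_restrict_Ico :
    IsProbabilityMeasure ((volume : Measure ℝ).restrict (Set.Ico 0 1)) :=
  ⟨by simp⟩

instance isProbabilityMeasure_μT (n : ℕ) : IsProbabilityMeasure (μT n) := by
  rw [μT_eq_pi]; infer_instance

lemma exists_int_of_mem_span {n : ℕ} {v : Fin n → ℝ}
    (hv : v ∈ Submodule.span ℤ (Set.range (Pi.basisFun ℝ (Fin n)))) :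
    ∃ w : Fin n → ℤ, v = fun j => (w j : ℝ) := by
  rw [Module.Basis.mem_span_iff_repr_mem] at hv
  choose w hw using hv
  exact ⟨w, funext fun j => by simpa using (hw j).symm⟩

/-- A periodic function has the same integral over every fundamental domain. -/
lemma setLIntegral_eq_of_isAddFundamentalDomain {n : ℕ} {g : (Fin n → ℝ) → ℝ≥0∞}
    (hg : ∀ (x : Fin n → ℝ) (v : Fin n → ℤ), g (x + fun j => (v j : ℝ)) = g x)
    {s : Set (Fin n → ℝ)}
    (hs : IsAddFundamentalDomain (Submodule.span ℤ (Set.range (Pi.basisFun ℝ (Fin n)))) s volume) :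
    ∫⁻ x in s, g x = ∫⁻ x, g x ∂(μT n) := by
  have : VAddInvariantMeasure (Submodule.span ℤ (Set.range (Pi.basisFun ℝ (Fin n))))
      (Fin n → ℝ) volume :=
    inferInstanceAs <| VAddInvariantMeasure
      (Submodule.span ℤ (Set.range (Pi.basisFun ℝ (Fin n)))).toAddSubgroup (Fin n → ℝ) volume
  rw [μT, cube_eq_fundamentalDomain]
  refine hs.setLIntegral_eq (ZSpan.isAddFundamentalDomain _ volume) g fun v x => ?_
  obtain ⟨w, hw⟩ := exists_int_of_mem_span v.2
  rw [Submodule.vadd_def, vadd_eq_add, add_comm, hw, hg]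

lemma lintegral_μT_add_right {n : ℕ} {g : (Fin n → ℝ) → ℝ≥0∞}
    (hg : ∀ (x : Fin n → ℝ) (v : Fin n → ℤ), g (x + fun j => (v j : ℝ)) = g x)
    (z : Fin n → ℝ) : ∫⁻ x, g (x + z) ∂(μT n) = ∫⁻ x, g x ∂(μT n) := by
  have h1 : IsAddFundamentalDomain (Submodule.span ℤ (Set.range (Pi.basisFun ℝ (Fin n))))
      ((Equiv.addRight z) '' cube n) volume := by
    rw [cube_eq_fundamentalDomain]
    refine (ZSpan.isAddFundamentalDomain (Pi.basisFun ℝ (Fin n)) volume).image_of_equiv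
      (Equiv.addRight z) ?_ (Equiv.refl _) ?_
    · exact (measurePreserving_add_right volume (-z)).quasiMeasurePreserving
    · intro v x
      simp [Submodule.vadd_def, add_assoc]
  rw [← setLIntegral_eq_of_isAddFundamentalDomain hg h1, μT,
    show (⇑(Equiv.addRight z)) = fun x => x + z from rfl,
    ← (measurePreserving_add_right volume z).setLIntegral_comp_emb
      (measurableEmbedding_addRight z)]

lemma lintegral_μT_sub_left {n : ℕ} {g : (Fin n → ℝ) → ℝ≥0∞}
    (hg : ∀ (x : Fin n → ℝ) (v : Fin n → ℤ), g (x + fun j => (v j : ℝ)) = g x)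
    (z : Fin n → ℝ) : ∫⁻ x, g (z - x) ∂(μT n) = ∫⁻ x, g x ∂(μT n) := by
  have h1 : IsAddFundamentalDomain (Submodule.span ℤ (Set.range (Pi.basisFun ℝ (Fin n))))
      ((Equiv.subLeft z) '' cube n) volume := by
    rw [cube_eq_fundamentalDomain]
    refine (ZSpan.isAddFundamentalDomain (Pi.basisFun ℝ (Fin n)) volume).image_of_equiv
      (Equiv.subLeft z) ?_ (Equiv.neg _) ?_
    · rw [show ⇑(Equiv.subLeft z).symm = fun x => z - x from
        funext fun x => by simp [sub_eq_neg_add]]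
      exact (Measure.measurePreserving_sub_left volume z).quasiMeasurePreserving
    · intro v x
      simp [Submodule.vadd_def]
      abel
  rw [← setLIntegral_eq_of_isAddFundamentalDomain hg h1, μT,
    show (⇑(Equiv.subLeft z)) = fun x => z - x from rfl,
    ← (Measure.measurePreserving_sub_left volume z).setLIntegral_comp_emb
      (MeasurableEquiv.subLeft z).measurableEmbedding]

lemma smul_cube_subset {n : ℕ} {t : ℝ} (ht0 : 0 < t) (ht1 : t ≤ 1) {y : Fin n → ℝ}
    (hy : y ∈ cube n) : t • y ∈ cube n := by
  intro j _
  have := hy j trivial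
  refine ⟨mul_nonneg ht0.le this.1, ?_⟩
  calc t * y j ≤ 1 * y j := by gcongr; exact this.1
    _ < 1 := by simpa using this.2

lemma lintegral_μT_dilate_le {n : ℕ} {g : (Fin n → ℝ) → ℝ≥0∞} (hgm : Measurable g)
    (hg : ∀ (x : Fin n → ℝ) (v : Fin n → ℤ), g (x + fun j => (v j : ℝ)) = g x)
    (z : Fin n → ℝ) {t : ℝ} (ht0 : 0 < t) (ht1 : t ≤ 1) :
    ∫⁻ y, g (z + t • y) ∂(μT n) ≤ ENNReal.ofReal (t ^ (-(n : ℝ))) * ∫⁻ x, g x ∂(μT n) := by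
  set h : (Fin n → ℝ) → ℝ≥0∞ := (cube n).indicator fun x => g (x + z) with hh
  have hhm : Measurable h :=
    (hgm.comp (measurable_add_const z)).indicator (measurableSet_cube n)
  calc ∫⁻ y, g (z + t • y) ∂(μT n) ≤ ∫⁻ y, h (t • y) ∂(μT n) := by
        refine setLIntegral_mono (hhm.comp (measurable_const_smul t)) fun y hy => ?_
        rw [hh, Set.indicator_of_mem (smul_cube_subset ht0 ht1 hy), add_comm]
    _ ≤ ∫⁻ y, h (t • y) := setLIntegral_le_lintegral _ _
    _ = ∫⁻ y, h y ∂(Measure.map (t • ·) volume) :=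
        (lintegral_map hhm (measurable_const_smul t)).symm
    _ = ENNReal.ofReal (t ^ (-(n : ℝ))) * ∫⁻ x, g x ∂(μT n) := by
        rw [Measure.map_addHaar_smul volume ht0.ne', lintegral_smul_measure,
          lintegral_indicator (measurableSet_cube n), ← lintegral_μT_add_right hg z, μT,
          Module.finrank_fin_fun, smul_eq_mul, abs_of_pos (by positivity), rpow_neg ht0.le,
          Real.rpow_natCast]

/-! ### Iterated partial derivatives -/

section Derivatives

variable {n : ℕ}

lemma ContDiff.pd {u : (Fin n → ℝ) → ℂ} (hu : ContDiff ℝ (⊤ : ℕ∞) u) (j : Fin n) :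
    ContDiff ℝ (⊤ : ℕ∞) (pd j u) :=
  (hu.fderiv_right (m := (⊤ : ℕ∞)) (by simp)).clm_apply contDiff_const

lemma ContDiff.foldr_pd {u : (Fin n → ℝ) → ℂ} (hu : ContDiff ℝ (⊤ : ℕ∞) u) (l : List (Fin n)) :
    ContDiff ℝ (⊤ : ℕ∞) (l.foldr _root_.pd u) := by
  induction l with
  | nil => exact hu
  | cons j l ih => exact ih.pd j

lemma pd_comm {u : (Fin n → ℝ) → ℂ} (hu : ContDiff ℝ (⊤ : ℕ∞) u) (i j : Fin n) :
    pd i (pd j u) = pd j (pd i u) := by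
  have hd : Differentiable ℝ (fderiv ℝ u) :=
    (hu.fderiv_right (m := (⊤ : ℕ∞)) (by simp)).differentiable (by simp)
  have key : ∀ (a b : Fin n) x, pd a (pd b u) x =
      fderiv ℝ (fderiv ℝ u) x (Pi.single a 1) (Pi.single b 1) := fun a b x => by
    change fderiv ℝ (fun y => fderiv ℝ u y (Pi.single b 1)) x (Pi.single a 1) = _
    rw [fderiv_clm_apply (hd x) (differentiableAt_const _)]
    simp
  ext x
  rw [key, key]
  exact (hu.contDiffAt.isSymmSndFDerivAt
    (by rw [minSmoothness_of_isRCLikeNormedField]; exact WithTop.coe_le_coe.2 le_top)).eq _ _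

lemma foldr_pd_perm {u : (Fin n → ℝ) → ℂ} (hu : ContDiff ℝ (⊤ : ℕ∞) u) {l l' : List (Fin n)}
    (h : l.Perm l') : l.foldr pd u = l'.foldr pd u := by
  induction h with
  | nil => rfl
  | cons j _ ih => simp only [List.foldr_cons, ih]
  | swap i j l => exact pd_comm (hu.foldr_pd l) j i
  | trans _ _ ih1 ih2 => exact ih1.trans ih2

lemma mIdxList_count_perm (l : List (Fin n)) : (mIdxList fun j => l.count j).Perm l := by
  rw [List.perm_iff_count]
  intro a
  rw [mIdxList, List.count_flatMap]
  simp only [Function.comp_def, List.count_replicate]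
  rw [← List.ofFn_eq_map, List.sum_ofFn]
  simp

lemma sum_count_eq_length (l : List (Fin n)) : ∑ j, l.count j = l.length := by
  have := List.sum_toFinset_count_eq_length l
  rw [← this]
  symm
  refine Finset.sum_subset (Finset.subset_univ _) fun j _ hj => ?_
  simpa [List.count_eq_zero] using hj

lemma differentiable_of_smooth {u : (Fin n → ℝ) → ℂ} (hu : ContDiff ℝ (⊤ : ℕ∞) u) :
    Differentiable ℝ u := hu.differentiable (by simp)

lemma pd_sub {u v : (Fin n → ℝ) → ℂ} (hu : ContDiff ℝ (⊤ : ℕ∞) u)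
    (hv : ContDiff ℝ (⊤ : ℕ∞) v) (j : Fin n) : pd j (u - v) = pd j u - pd j v := by
  ext x
  simp [pd, fderiv_sub (differentiable_of_smooth hu x) (differentiable_of_smooth hv x)]

lemma foldr_pd_sub {u v : (Fin n → ℝ) → ℂ} (hu : ContDiff ℝ (⊤ : ℕ∞) u)
    (hv : ContDiff ℝ (⊤ : ℕ∞) v) (l : List (Fin n)) :
    l.foldr pd (u - v) = l.foldr pd u - l.foldr pd v := by
  induction l with
  | nil => rfl
  | cons j l ih => rw [List.foldr_cons, ih, pd_sub (hu.foldr_pd l) (hv.foldr_pd l)]; rfl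

lemma foldr_pd_sum_mul {ι : Type*} (s : Finset ι) (c : ι → ℂ) {u : ι → (Fin n → ℝ) → ℂ}
    (hu : ∀ i, ContDiff ℝ (⊤ : ℕ∞) (u i)) (l : List (Fin n)) :
    l.foldr pd (fun x => ∑ i ∈ s, c i * u i x) = fun x => ∑ i ∈ s, c i * l.foldr pd (u i) x := by
  induction l with
  | nil => rfl
  | cons j l ih =>
    rw [List.foldr_cons, ih]
    ext x
    have hd : ∀ i, DifferentiableAt ℝ (l.foldr pd (u i)) x := fun i =>
      differentiable_of_smooth ((hu i).foldr_pd l) x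
    simp only [pd]
    rw [fderiv_fun_sum fun i _ => (hd i).const_mul _]
    simp [fderiv_const_mul (hd _), pd]

lemma Per.pd {u : (Fin n → ℝ) → ℂ} (hu : Per u) (j : Fin n) : Per (pd j u) := by
  intro x v
  have : (fun y => u (y + fun j => (v j : ℝ))) = u := funext fun y => hu y v
  simp only [_root_.pd]
  rw [← fderiv_comp_add_right, this]

lemma Per.foldr_pd {u : (Fin n → ℝ) → ℂ} (hu : Per u) (l : List (Fin n)) :
    Per (l.foldr _root_.pd u) := by
  induction l with
  | nil => exact hu
  | cons j l ih => exact ih.pd j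

lemma fderiv_eq_sum_pd (u : (Fin n → ℝ) → ℂ) (y : Fin n → ℝ) :
    (fun x => fderiv ℝ u x y) = fun x => ∑ j, (y j : ℂ) * pd j u x := by
  ext x
  conv_lhs => rw [pi_eq_sum_univ' y]
  simp [pd, map_sum]

/-- Iterated derivative in the direction `y`. -/
def dirD (y : Fin n → ℝ) (u : (Fin n → ℝ) → ℂ) : (Fin n → ℝ) → ℂ := fun x => fderiv ℝ u x y

lemma ContDiff.dirD {u : (Fin n → ℝ) → ℂ} (hu : ContDiff ℝ (⊤ : ℕ∞) u) (y : Fin n → ℝ) :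
    ContDiff ℝ (⊤ : ℕ∞) (dirD y u) :=
  (hu.fderiv_right (m := (⊤ : ℕ∞)) (by simp)).clm_apply contDiff_const

lemma ContDiff.iterate_dirD {u : (Fin n → ℝ) → ℂ} (hu : ContDiff ℝ (⊤ : ℕ∞) u)
    (y : Fin n → ℝ) (m : ℕ) : ContDiff ℝ (⊤ : ℕ∞) ((_root_.dirD y)^[m] u) := by
  induction m with
  | zero => exact hu
  | succ m ih => rw [Function.iterate_succ_apply']; exact ih.dirD y

lemma dirD_sum_mul {ι : Type*} (s : Finset ι) (c : ι → ℂ) {u : ι → (Fin n → ℝ) → ℂ}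
    (hu : ∀ i, ContDiff ℝ (⊤ : ℕ∞) (u i)) (y : Fin n → ℝ) :
    dirD y (fun x => ∑ i ∈ s, c i * u i x) = fun x => ∑ i ∈ s, c i * dirD y (u i) x := by
  ext x
  have hd : ∀ i, DifferentiableAt ℝ (u i) x := fun i => differentiable_of_smooth (hu i) x
  simp only [dirD]
  rw [fderiv_fun_sum fun i _ => (hd i).const_mul _]
  simp [fderiv_const_mul (hd _)]

lemma iterate_dirD_sum_mul {ι : Type*} (s : Finset ι) (c : ι → ℂ) {u : ι → (Fin n → ℝ) → ℂ}
    (hu : ∀ i, ContDiff ℝ (⊤ : ℕ∞) (u i)) (y : Fin n → ℝ) (m : ℕ) :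
    (dirD y)^[m] (fun x => ∑ i ∈ s, c i * u i x) =
      fun x => ∑ i ∈ s, c i * (dirD y)^[m] (u i) x := by
  induction m with
  | zero => rfl
  | succ m ih =>
    simp only [Function.iterate_succ_apply']
    rw [ih, dirD_sum_mul s c fun i => (hu i).iterate_dirD y m]

lemma norm_iterate_dirD_le {x y : Fin n → ℝ} (hy : ∀ j, |y j| ≤ 1) {H : ℝ} (m : ℕ) :
    ∀ {u : (Fin n → ℝ) → ℂ}, ContDiff ℝ (⊤ : ℕ∞) u →
      (∀ l : List (Fin n), l.length = m → ‖l.foldr pd u x‖ ≤ H) →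
      ‖(dirD y)^[m] u x‖ ≤ (n : ℝ) ^ m * H := by
  induction m with
  | zero => intro u hu h; simpa using h [] rfl
  | succ m ih =>
    intro u hu h
    rw [Function.iterate_succ_apply, show dirD y u = _ from fderiv_eq_sum_pd u y,
      iterate_dirD_sum_mul _ _ fun j => hu.pd j]
    calc ‖∑ j, (y j : ℂ) * (dirD y)^[m] (pd j u) x‖
        ≤ ∑ j, ‖(y j : ℂ) * (dirD y)^[m] (pd j u) x‖ := norm_sum_le _ _
      _ ≤ ∑ _j : Fin n, 1 * ((n : ℝ) ^ m * H) := by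
          refine Finset.sum_le_sum fun j _ => ?_
          rw [norm_mul, Complex.norm_real]
          refine mul_le_mul (hy j) (ih (hu.pd j) fun l hl => ?_) (norm_nonneg _) zero_le_one
          have := h (l ++ [j]) (by simp [hl])
          simpa using this
      _ = (n : ℝ) ^ (m + 1) * H := by
          simp [pow_succ]; ring

/-- The multi-indices of order at most `M`. -/
def mIdxLe (n M : ℕ) : Finset (Fin n → ℕ) :=
  (Fintype.piFinset fun _ => Finset.range (M + 1)).filter fun β => ∑ j, β j ≤ M

lemma mem_mIdxLe {M : ℕ} {β : Fin n → ℕ} : β ∈ mIdxLe n M ↔ ∑ j, β j ≤ M := by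
  simp only [mIdxLe, Finset.mem_filter, Fintype.mem_piFinset, Finset.mem_range,
    and_iff_right_iff_imp]
  intro h j
  exact Nat.lt_succ_of_le ((Finset.single_le_sum (fun _ _ => Nat.zero_le _)
    (Finset.mem_univ j)).trans h)

/-- The sum of the norms of the partial derivatives of order at most `M`. -/
def sumPd (M : ℕ) (u : (Fin n → ℝ) → ℂ) (x : Fin n → ℝ) : ℝ := ∑ β ∈ mIdxLe n M, ‖pdM β u x‖

lemma norm_foldr_pd_le_sumPd {u : (Fin n → ℝ) → ℂ} (hu : ContDiff ℝ (⊤ : ℕ∞) u) {M : ℕ}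
    {l : List (Fin n)} (hl : l.length ≤ M) (x : Fin n → ℝ) :
    ‖l.foldr pd u x‖ ≤ sumPd M u x := by
  rw [← foldr_pd_perm hu (mIdxList_count_perm l)]
  exact Finset.single_le_sum (f := fun β => ‖pdM β u x‖) (fun _ _ => norm_nonneg _)
    (mem_mIdxLe.2 (by rwa [sum_count_eq_length]))

lemma sumPd_nonneg (M : ℕ) (u : (Fin n → ℝ) → ℂ) (x : Fin n → ℝ) : 0 ≤ sumPd M u x :=
  Finset.sum_nonneg fun _ _ => norm_nonneg _

lemma continuous_sumPd {u : (Fin n → ℝ) → ℂ} (hu : ContDiff ℝ (⊤ : ℕ∞) u) (M : ℕ) :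
    Continuous (sumPd M u) :=
  continuous_finsetSum _ fun _ _ => (hu.foldr_pd _).continuous.norm

lemma norm_iterate_dirD_le_sumPd {u : (Fin n → ℝ) → ℂ} (hu : ContDiff ℝ (⊤ : ℕ∞) u) {M m : ℕ}
    (hm : m ≤ M) {y : Fin n → ℝ} (hy : ∀ j, |y j| ≤ 1) (x : Fin n → ℝ) :
    ‖(dirD y)^[m] u x‖ ≤ (n : ℝ) ^ m * sumPd M u x :=
  norm_iterate_dirD_le hy m hu fun _ hl => norm_foldr_pd_le_sumPd hu (hl.trans_le hm) x

end Derivatives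

/-! ### Sobolev embedding -/

section Sobolev

variable {n : ℕ}

lemma hasDerivAt_comp_line {u : (Fin n → ℝ) → ℂ} (hu : ContDiff ℝ (⊤ : ℕ∞) u)
    (z y : Fin n → ℝ) (t : ℝ) :
    HasDerivAt (fun s : ℝ => u (z + s • y)) (dirD y u (z + t • y)) t := by
  have h1 : HasDerivAt (fun s : ℝ => z + s • y) y t := by
    simpa using ((hasDerivAt_id t).smul_const y).const_add z
  exact (differentiable_of_smooth hu _).hasFDerivAt.comp_hasDerivAt t h1

lemma norm_le_sum_add_remainder {u : (Fin n → ℝ) → ℂ} (hu : ContDiff ℝ (⊤ : ℕ∞) u)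
    (z y : Fin n → ℝ) (m : ℕ) :
    ‖u z‖ ≤ ∑ j ∈ Finset.range (m + 1), ‖(dirD y)^[j] u (z + y)‖ +
      ‖∫ t in (0 : ℝ)..1, ((t ^ m : ℝ) : ℂ) * (dirD y)^[m + 1] u (z + t • y)‖ := by
  have hline : Continuous fun t : ℝ => z + t • y := by fun_prop
  have hcont : ∀ m, Continuous fun t : ℝ => (dirD y)^[m] u (z + t • y) := fun m =>
    (hu.iterate_dirD y m).continuous.comp hline
  have hder : ∀ m t, HasDerivAt (fun s : ℝ => (dirD y)^[m] u (z + s • y))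
      ((dirD y)^[m + 1] u (z + t • y)) t := fun m t => by
    rw [Function.iterate_succ_apply']
    exact hasDerivAt_comp_line (hu.iterate_dirD y m) z y t
  induction m with
  | zero =>
    have h := intervalIntegral.integral_eq_sub_of_hasDerivAt (a := 0) (b := 1)
      (fun t _ => hder 0 t) ((hcont 1).intervalIntegrable _ _)
    simp only [Function.iterate_zero, id, one_smul, zero_smul, add_zero] at h
    simp only [pow_zero, Complex.ofReal_one, one_mul, h]
    calc ‖u z‖ = ‖u (z + y) - (u (z + y) - u z)‖ := by simp
      _ ≤ _ := by simpa using norm_sub_le (u (z + y)) (u (z + y) - u z)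
  | succ m ih =>
    rw [Finset.sum_range_succ, add_assoc]
    refine ih.trans (add_le_add_right ?_ _)
    have hp : ∀ t : ℝ, HasDerivAt (fun s : ℝ => ((s ^ (m + 1) : ℝ) : ℂ))
        (((m + 1 : ℕ) * t ^ m : ℝ) : ℂ) t := fun t => by
      simpa using (hasDerivAt_pow (m + 1) t).ofReal_comp
    have h := intervalIntegral.integral_mul_deriv_eq_deriv_mul (a := 0) (b := 1)
      (fun t _ => hp t) (fun t _ => hder (m + 1) t)
      (Continuous.intervalIntegrable (by fun_prop) _ _)
      ((hcont (m + 2)).intervalIntegrable _ _)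
    rw [h]
    have e : (∫ t in (0 : ℝ)..1, (((m + 1 : ℕ) * t ^ m : ℝ) : ℂ) * (dirD y)^[m + 1] u (z + t • y))
        = (m + 1 : ℕ) * ∫ t in (0 : ℝ)..1, ((t ^ m : ℝ) : ℂ) * (dirD y)^[m + 1] u (z + t • y) := by
      rw [← intervalIntegral.integral_const_mul]
      simp only [Complex.ofReal_mul, Complex.ofReal_natCast, mul_assoc]
    rw [e]
    set I := ∫ t in (0 : ℝ)..1, ((t ^ m : ℝ) : ℂ) * (dirD y)^[m + 1] u (z + t • y)
    simp only [one_pow, Complex.ofReal_one, one_mul, one_smul, zero_smul, add_zero, ne_eq,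
      Nat.succ_ne_zero, not_false_eq_true, zero_pow, Complex.ofReal_zero, zero_mul, sub_zero]
    set G := (dirD y)^[m + 1] u (z + y)
    calc ‖I‖ ≤ (m + 1 : ℕ) * ‖I‖ := by
          refine le_mul_of_one_le_left (norm_nonneg _) ?_
          push_cast; linarith [(Nat.cast_nonneg m : (0 : ℝ) ≤ m)]
      _ = ‖((m + 1 : ℕ) : ℂ) * I‖ := by rw [norm_mul, Complex.norm_natCast]
      _ = ‖G - (G - ((m + 1 : ℕ) : ℂ) * I)‖ := by congr 1; ring
      _ ≤ _ := norm_sub_le _ _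

lemma norm_le_sumPd_add_integral {u : (Fin n → ℝ) → ℂ} (hu : ContDiff ℝ (⊤ : ℕ∞) u) (m : ℕ)
    (z : Fin n → ℝ) {y : Fin n → ℝ} (hy : ∀ j, |y j| ≤ 1) :
    ‖u z‖ ≤ (m + 1) * (n + 1) ^ (m + 1) * (sumPd (m + 1) u (z + y) +
      ∫ t in (0 : ℝ)..1, t ^ m * sumPd (m + 1) u (z + t • y)) := by
  have hn : (0 : ℝ) ≤ n := Nat.cast_nonneg n
  have hb : ∀ j ≤ m + 1, ∀ x, ‖(dirD y)^[j] u x‖ ≤ (n + 1) ^ (m + 1) * sumPd (m + 1) u x := by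
    intro j hj x
    refine (norm_iterate_dirD_le_sumPd hu hj hy x).trans
      (mul_le_mul_of_nonneg_right ?_ (sumPd_nonneg _ _ _))
    calc (n : ℝ) ^ j ≤ (n + 1) ^ j := by gcongr; linarith
      _ ≤ (n + 1) ^ (m + 1) := pow_le_pow_right₀ (by linarith) hj
  have hc : Continuous fun t : ℝ => sumPd (m + 1) u (z + t • y) :=
    (continuous_sumPd hu _).comp (by fun_prop)
  have hI0 : 0 ≤ ∫ t in (0 : ℝ)..1, t ^ m * sumPd (m + 1) u (z + t • y) :=
    intervalIntegral.integral_nonneg zero_le_one fun t ht =>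
      mul_nonneg (pow_nonneg ht.1 _) (sumPd_nonneg _ _ _)
  have h2 : ‖∫ t in (0 : ℝ)..1, ((t ^ m : ℝ) : ℂ) * (dirD y)^[m + 1] u (z + t • y)‖ ≤
      (n + 1) ^ (m + 1) * ∫ t in (0 : ℝ)..1, t ^ m * sumPd (m + 1) u (z + t • y) := by
    rw [← intervalIntegral.integral_const_mul]
    refine intervalIntegral.norm_integral_le_of_norm_le zero_le_one
      (Filter.Eventually.of_forall fun t ht => ?_)
      (Continuous.intervalIntegrable (by fun_prop) _ _)
    rw [norm_mul, Complex.norm_real, norm_of_nonneg (pow_nonneg ht.1.le _), mul_left_comm]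
    exact mul_le_mul_of_nonneg_left (hb _ le_rfl _) (pow_nonneg ht.1.le _)
  have h1 : ∑ j ∈ Finset.range (m + 1), ‖(dirD y)^[j] u (z + y)‖ ≤
      (m + 1) * ((n + 1) ^ (m + 1) * sumPd (m + 1) u (z + y)) := by
    refine (Finset.sum_le_sum fun j hj => hb j (Finset.mem_range.1 hj).le _).trans ?_
    simp
  refine (norm_le_sum_add_remainder hu z y m).trans ((add_le_add h1 h2).trans ?_)
  have h3 : (0 : ℝ) ≤ m * ((n + 1) ^ (m + 1) *
      ∫ t in (0 : ℝ)..1, t ^ m * sumPd (m + 1) u (z + t • y)) := by positivity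
  linarith

lemma lintegral_le_rpow_lintegral_rpow {α : Type*} [MeasurableSpace α] {μ : Measure α}
    [IsProbabilityMeasure μ] {g : α → ℝ≥0∞} (hg : AEMeasurable g μ) {p : ℝ} (hp : 1 ≤ p) :
    ∫⁻ x, g x ∂μ ≤ (∫⁻ x, g x ^ p ∂μ) ^ (1 / p) := by
  simpa [eLpNorm'] using
    eLpNorm'_le_eLpNorm'_of_exponent_le one_pos hp μ hg.aestronglyMeasurable

lemma Per.comp_sumPd {u : (Fin n → ℝ) → ℂ} (hu : Per u) (M : ℕ) (x : Fin n → ℝ)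
    (v : Fin n → ℤ) : sumPd M u (x + fun j => (v j : ℝ)) = sumPd M u x :=
  Finset.sum_congr rfl fun β _ => by rw [pdM, hu.foldr_pd]

/-- Sobolev's embedding of `W^{m+1,p}(𝕋ⁿ)` into the bounded functions, for `m + 1 > n / p`. -/
lemma exists_enorm_le_sobolev (n m : ℕ) {p : ℝ} (hp : 1 ≤ p) (hm : (n : ℝ) / p < m + 1) :
    ∃ A : NNReal, ∀ u : (Fin n → ℝ) → ℂ, ContDiff ℝ (⊤ : ℕ∞) u → Per u → ∀ z,
      ‖u z‖ₑ ≤ A * (∫⁻ x, ENNReal.ofReal (sumPd (m + 1) u x) ^ p ∂(μT n)) ^ (1 / p) := by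
  have hp0 : 0 < p := by linarith
  set J : ℝ≥0∞ := ∫⁻ t in Set.Ioc (0 : ℝ) 1, ENNReal.ofReal (t ^ ((m : ℝ) - n / p)) with hJ
  have hJt : J ≠ ⊤ := by
    have h1 : IntegrableOn (fun t : ℝ => t ^ ((m : ℝ) - n / p)) (Set.Ioc 0 1) volume := by
      rw [← intervalIntegrable_iff_integrableOn_Ioc_of_le zero_le_one]
      exact intervalIntegral.intervalIntegrable_rpow' (by linarith)
    exact h1.lintegral_lt_top.ne
  set B : ℝ := (m + 1) * (n + 1) ^ (m + 1) with hB
  have hB0 : 0 ≤ B := by positivity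
  have hAt : ENNReal.ofReal B * (1 + J) ≠ ⊤ :=
    ENNReal.mul_ne_top ENNReal.ofReal_ne_top (ENNReal.add_ne_top.2 ⟨ENNReal.one_ne_top, hJt⟩)
  refine ⟨(ENNReal.ofReal B * (1 + J)).toNNReal, fun u hu hper z => ?_⟩
  rw [ENNReal.coe_toNNReal hAt]
  set h : (Fin n → ℝ) → ℝ≥0∞ := fun x => ENNReal.ofReal (sumPd (m + 1) u x) with hh
  have hhm : Measurable h := (continuous_sumPd hu _).measurable.ennreal_ofReal
  have hhper : ∀ (x : Fin n → ℝ) (v : Fin n → ℤ), h (x + fun j => (v j : ℝ)) = h x :=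
    fun x v => by simp only [hh, hper.comp_sumPd]
  have hpper : ∀ (x : Fin n → ℝ) (v : Fin n → ℤ), h (x + fun j => (v j : ℝ)) ^ p = h x ^ p :=
    fun x v => by rw [hhper]
  set N : ℝ≥0∞ := (∫⁻ x, h x ^ p ∂(μT n)) ^ (1 / p) with hN
  have hpt : ∀ y ∈ cube n, ‖u z‖ₑ ≤ ENNReal.ofReal B *
      (h (y + z) + ∫⁻ t in Set.Ioc (0 : ℝ) 1, ENNReal.ofReal (t ^ m) * h (z + t • y)) := by
    intro y hy
    have hy1 : ∀ j, |y j| ≤ 1 := fun j => by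
      rw [abs_of_nonneg (hy j trivial).1]; exact (hy j trivial).2.le
    have hc : Continuous fun t : ℝ => t ^ m * sumPd (m + 1) u (z + t • y) :=
      (continuous_pow m).mul ((continuous_sumPd hu _).comp (by fun_prop))
    have h0 := norm_le_sumPd_add_integral hu m z hy1
    rw [← ofReal_norm]
    refine (ENNReal.ofReal_le_ofReal h0).trans ?_
    rw [ENNReal.ofReal_mul hB0]
    gcongr
    refine ENNReal.ofReal_add_le.trans ?_
    rw [add_comm z y]
    gcongr
    rw [intervalIntegral.integral_of_le zero_le_one, ofReal_integral_eq_lintegral_ofReal]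
    · refine (setLIntegral_congr_fun measurableSet_Ioc fun t ht => ?_).le
      simp only [hh]
      rw [ENNReal.ofReal_mul (pow_nonneg ht.1.le _)]
    · exact (hc.integrableOn_Icc (a := 0) (b := 1)).mono_set Set.Ioc_subset_Icc_self
    · exact (ae_restrict_iff' measurableSet_Ioc).2 (Filter.Eventually.of_forall fun t ht =>
        mul_nonneg (pow_nonneg ht.1.le _) (sumPd_nonneg _ _ _))
  have hmeas2 : Measurable fun q : (Fin n → ℝ) × ℝ =>
      ENNReal.ofReal (q.2 ^ m) * h (z + q.2 • q.1) :=
    (measurable_snd.pow_const m).ennreal_ofReal.mul (hhm.comp (by fun_prop))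
  have hdil : ∀ t ∈ Set.Ioc (0 : ℝ) 1, ENNReal.ofReal (t ^ m) * ∫⁻ y, h (z + t • y) ∂(μT n) ≤
      ENNReal.ofReal (t ^ ((m : ℝ) - n / p)) * N := by
    intro t ht
    have h1 : ∫⁻ y, h (z + t • y) ∂(μT n) ≤ ENNReal.ofReal (t ^ (-(n / p : ℝ))) * N := by
      refine (lintegral_le_rpow_lintegral_rpow
        (hhm.comp (by fun_prop : Measurable fun y => z + t • y)).aemeasurable hp).trans ?_
      refine (ENNReal.rpow_le_rpow (lintegral_μT_dilate_le (hhm.pow_const p) hpper z ht.1 ht.2)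
        (by positivity)).trans ?_
      rw [ENNReal.mul_rpow_of_nonneg _ _ (by positivity),
        ENNReal.ofReal_rpow_of_pos (rpow_pos_of_pos ht.1 _), ← Real.rpow_mul ht.1.le]
      refine le_of_eq ?_
      congr 3
      ring
    refine (mul_le_mul_right h1 _).trans ?_
    rw [← mul_assoc, ← ENNReal.ofReal_mul (pow_nonneg ht.1.le _), ← Real.rpow_natCast,
      ← Real.rpow_add ht.1, sub_eq_add_neg]
  calc ‖u z‖ₑ = ∫⁻ _y, ‖u z‖ₑ ∂(μT n) := by simp
    _ ≤ ∫⁻ y, ENNReal.ofReal B *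
        (h (y + z) + ∫⁻ t in Set.Ioc (0 : ℝ) 1, ENNReal.ofReal (t ^ m) * h (z + t • y)) ∂(μT n) :=
        setLIntegral_mono' (measurableSet_cube n) hpt
    _ = ENNReal.ofReal B * (∫⁻ y, h (y + z) ∂(μT n) + ∫⁻ y,
          (∫⁻ t in Set.Ioc (0 : ℝ) 1, ENNReal.ofReal (t ^ m) * h (z + t • y)) ∂(μT n)) := by
        rw [lintegral_const_mul' _ _ ENNReal.ofReal_ne_top,
          lintegral_add_left (by fun_prop : Measurable fun y => h (y + z))]
    _ = ENNReal.ofReal B * (∫⁻ y, h y ∂(μT n) + ∫⁻ t in Set.Ioc (0 : ℝ) 1,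
          ENNReal.ofReal (t ^ m) * ∫⁻ y, h (z + t • y) ∂(μT n)) := by
        rw [lintegral_μT_add_right hhper, lintegral_lintegral_swap hmeas2.aemeasurable]
        simp_rw [lintegral_const_mul' _ _ ENNReal.ofReal_ne_top]
    _ ≤ ENNReal.ofReal B * (N + ∫⁻ t in Set.Ioc (0 : ℝ) 1,
          ENNReal.ofReal (t ^ ((m : ℝ) - n / p)) * N) := by
        gcongr ENNReal.ofReal B * (?_ + ?_)
        · exact lintegral_le_rpow_lintegral_rpow hhm.aemeasurable hp
        · exact setLIntegral_mono' measurableSet_Ioc hdil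
    _ = ENNReal.ofReal B * (1 + J) * N := by
        rw [lintegral_mul_const _ (by fun_prop), ← hJ]
        ring

end Sobolev

/-! ### Trigonometric polynomials -/

section Trig

variable {n : ℕ}

lemma eChar_add_left (x y : Fin n → ℝ) (ξ : Fin n → ℤ) :
    eChar (x + y) ξ = eChar x ξ * eChar y ξ := by
  rw [eChar, eChar, eChar, ← Complex.exp_add, ← mul_add, ← Finset.sum_add_distrib]
  simp [add_mul]

lemma eChar_add_right (x : Fin n → ℝ) (ξ η : Fin n → ℤ) :
    eChar x (ξ + η) = eChar x ξ * eChar x η := by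
  rw [eChar, eChar, eChar, ← Complex.exp_add, ← mul_add, ← Finset.sum_add_distrib]
  simp [mul_add]

lemma eChar_eq_exp_ofReal (x : Fin n → ℝ) (ξ : Fin n → ℤ) :
    eChar x ξ = Complex.exp (((2 * π * ∑ j, x j * ξ j : ℝ) : ℂ) * Complex.I) := by
  rw [eChar]
  push_cast
  ring_nf

@[simp] lemma norm_eChar (x : Fin n → ℝ) (ξ : Fin n → ℤ) : ‖eChar x ξ‖ = 1 := by
  rw [eChar_eq_exp_ofReal, Complex.norm_exp_ofReal_mul_I]

@[simp] lemma eChar_zero_right (x : Fin n → ℝ) : eChar x 0 = 1 := by simp [eChar]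

lemma eChar_neg_right (x : Fin n → ℝ) (ξ : Fin n → ℤ) :
    eChar x (-ξ) = (starRingEnd ℂ) (eChar x ξ) := by
  rw [eChar_eq_exp_ofReal, eChar_eq_exp_ofReal, ← Complex.exp_conj, map_mul, Complex.conj_ofReal,
    Complex.conj_I]
  simp

lemma eChar_intCast (v ξ : Fin n → ℤ) : eChar (fun j => (v j : ℝ)) ξ = 1 := by
  rw [eChar, Complex.exp_eq_one_iff]
  exact ⟨∑ j, v j * ξ j, by push_cast; ring⟩

lemma eChar_add_intCast (x : Fin n → ℝ) (v ξ : Fin n → ℤ) :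
    eChar (x + fun j => (v j : ℝ)) ξ = eChar x ξ := by
  rw [eChar_add_left, eChar_intCast, mul_one]

@[fun_prop] lemma continuous_eChar (ξ : Fin n → ℤ) : Continuous fun x => eChar x ξ := by
  unfold eChar; fun_prop

lemma integral_eChar (ξ : Fin n → ℤ) : ∫ x, eChar x ξ ∂(μT n) = if ξ = 0 then 1 else 0 := by
  split_ifs with h
  · simp [h]
  obtain ⟨j, hj⟩ : ∃ j, ξ j ≠ 0 := by
    by_contra! h0
    exact h (funext h0)
  have h1 : ∀ x, eChar x ξ =
      ∏ j, Complex.exp (2 * (π : ℂ) * Complex.I * (ξ j : ℂ) * (x j : ℂ)) := fun x => by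
    rw [eChar, ← Complex.exp_sum, Finset.mul_sum]
    congr 1
    exact Finset.sum_congr rfl fun j _ => by ring
  simp_rw [h1, μT_eq_pi]
  rw [integral_fintype_prod_eq_prod
    (f := fun j (s : ℝ) => Complex.exp (2 * (π : ℂ) * Complex.I * (ξ j : ℂ) * (s : ℂ)))]
  refine Finset.prod_eq_zero (Finset.mem_univ j) ?_
  have hc : 2 * (π : ℂ) * Complex.I * (ξ j : ℂ) ≠ 0 := by
    simp [hj, Real.pi_ne_zero, Complex.I_ne_zero]
  rw [integral_Ico_eq_integral_Ioc, ← intervalIntegral.integral_of_le zero_le_one,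
    integral_exp_mul_complex hc]
  have : Complex.exp (2 * (π : ℂ) * Complex.I * (ξ j : ℂ) * ((1 : ℝ) : ℂ)) = 1 := by
    rw [Complex.exp_eq_one_iff]
    exact ⟨ξ j, by push_cast; ring⟩
  rw [this]
  simp

/-- The trigonometric series with coefficients `a`. -/
def trig (a : (Fin n → ℤ) → ℂ) (x : Fin n → ℝ) : ℂ := ∑' ξ, eChar x ξ * a ξ

lemma trig_eq_sum {a : (Fin n → ℤ) → ℂ} {S : Finset (Fin n → ℤ)} (ha : ∀ ξ ∉ S, a ξ = 0)
    (x : Fin n → ℝ) : trig a x = ∑ ξ ∈ S, eChar x ξ * a ξ :=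
  tsum_eq_sum fun ξ hξ => by rw [ha ξ hξ, mul_zero]

lemma continuous_trig {a : (Fin n → ℤ) → ℂ} {S : Finset (Fin n → ℤ)} (ha : ∀ ξ ∉ S, a ξ = 0) :
    Continuous (trig a) := by
  rw [funext (trig_eq_sum ha)]
  fun_prop

lemma trig_add_intCast (a : (Fin n → ℤ) → ℂ) (x : Fin n → ℝ) (v : Fin n → ℤ) :
    trig a (x + fun j => (v j : ℝ)) = trig a x := by
  simp_rw [trig, eChar_add_intCast]

lemma finite_support_dd {a : (Fin n → ℤ) → ℂ} (ha : a.support.Finite) (j : Fin n) :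
    (dd j a).support.Finite := by
  refine Set.Finite.subset (((ha.preimage
    (add_left_injective (Pi.single j (1 : ℤ))).injOn)).union ha) fun ξ hξ => ?_
  by_contra h
  simp only [Set.mem_union, Set.mem_preimage, Function.mem_support, not_or, not_not] at h
  exact hξ (by simp [dd, h.1, h.2])

lemma summable_trig {a : (Fin n → ℤ) → ℂ} (ha : a.support.Finite) (x : Fin n → ℝ) :
    Summable fun ξ => eChar x ξ * a ξ :=
  summable_of_hasFiniteSupport (ha.subset fun _ hξ => right_ne_zero_of_mul hξ)

lemma trig_dd {a : (Fin n → ℤ) → ℂ} (ha : a.support.Finite) (j : Fin n) (x : Fin n → ℝ) :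
    trig (dd j a) x = (eChar x (-Pi.single j 1) - 1) * trig a x := by
  obtain ⟨e, he⟩ : ∃ e : Fin n → ℤ, e = Pi.single j 1 := ⟨_, rfl⟩
  obtain ⟨G, hG⟩ : ∃ G : (Fin n → ℤ) → ℂ, G = fun ξ => eChar x ξ * a ξ := ⟨_, rfl⟩
  have h2 : Summable G := hG ▸ summable_trig ha x
  have h1 : Summable fun ξ => G (ξ + e) := (Equiv.addRight e).summable_iff.2 h2
  have h3 : ∑' ξ, G (ξ + e) = trig a x := by
    rw [trig, ← hG]
    exact (Equiv.addRight e).tsum_eq G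
  have key : ∀ ξ, eChar x ξ * dd j a ξ = eChar x (-e) * G (ξ + e) - G ξ := by
    intro ξ
    rw [hG]
    simp only [dd, ← he]
    rw [← mul_assoc, ← eChar_add_right, mul_sub, show -e + (ξ + e) = ξ by abel]
  have h4 : trig a x = ∑' ξ, G ξ := by rw [trig, hG]
  rw [trig, ← he, tsum_congr key, (h1.mul_left _).tsum_sub h2, tsum_mul_left, h3, ← h4]
  ring

lemma finite_support_iterate_dd {a : (Fin n → ℤ) → ℂ} (ha : a.support.Finite) (j : Fin n)
    (N : ℕ) : ((dd j)^[N] a).support.Finite := by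
  induction N with
  | zero => simpa
  | succ N ih => rw [Function.iterate_succ_apply']; exact finite_support_dd ih j

lemma trig_iterate_dd {a : (Fin n → ℤ) → ℂ} (ha : a.support.Finite) (j : Fin n) (N : ℕ)
    (x : Fin n → ℝ) :
    trig ((dd j)^[N] a) x = (eChar x (-Pi.single j 1) - 1) ^ N * trig a x := by
  induction N with
  | zero => simp
  | succ N ih =>
    rw [Function.iterate_succ_apply', trig_dd (finite_support_iterate_dd ha j N), ih]
    ring

lemma finite_support_of_eq_zero {a : (Fin n → ℤ) → ℂ} {S : Finset (Fin n → ℤ)}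
    (ha : ∀ ξ ∉ S, a ξ = 0) : a.support.Finite :=
  S.finite_toSet.subset fun ξ hξ => by
    by_contra h
    exact hξ (ha ξ h)

lemma integrable_μT_of_continuous {E : Type*} [NormedAddCommGroup E] {g : (Fin n → ℝ) → E}
    (hg : Continuous g) : Integrable g (μT n) := by
  have : IsCompact (Set.univ.pi fun _ : Fin n => Set.Icc (0 : ℝ) 1) :=
    isCompact_univ_pi fun _ => isCompact_Icc
  exact (hg.continuousOn.integrableOn_compact this).mono_set
    (Set.pi_mono fun _ _ => Set.Ico_subset_Icc_self)

lemma integral_norm_trig_sq {a : (Fin n → ℤ) → ℂ} {S : Finset (Fin n → ℤ)}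
    (ha : ∀ ξ ∉ S, a ξ = 0) :
    ∫ x, ‖trig a x‖ ^ 2 ∂(μT n) = ∑ ξ ∈ S, ‖a ξ‖ ^ 2 := by
  apply Complex.ofReal_injective
  rw [← integral_complex_ofReal]
  have h1 : ∀ x, ((‖trig a x‖ ^ 2 : ℝ) : ℂ) = ∑ ξ ∈ S, ∑ η ∈ S,
      (a ξ * (starRingEnd ℂ) (a η)) * eChar x (ξ - η) := by
    intro x
    rw [← Complex.normSq_eq_norm_sq, ← Complex.mul_conj, trig_eq_sum ha, map_sum,
      Finset.sum_mul_sum]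
    refine Finset.sum_congr rfl fun ξ _ => Finset.sum_congr rfl fun η _ => ?_
    rw [sub_eq_add_neg, eChar_add_right, eChar_neg_right, map_mul]
    ring
  simp_rw [h1]
  rw [integral_finsetSum _ fun ξ _ => integrable_finsetSum _ fun η _ =>
    integrable_μT_of_continuous (by fun_prop)]
  rw [Complex.ofReal_sum]
  refine Finset.sum_congr rfl fun ξ hξ => ?_
  rw [integral_finsetSum _ fun η _ => integrable_μT_of_continuous (by fun_prop)]
  rw [Finset.sum_eq_single ξ]
  · rw [integral_const_mul, integral_eChar, sub_self, if_pos rfl, mul_one, Complex.mul_conj,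
      Complex.normSq_eq_norm_sq]
  · intro η _ hη
    rw [integral_const_mul, integral_eChar, if_neg (sub_ne_zero.2 hη.symm), mul_zero]
  · exact fun h => (h hξ).elim

end Trig

/-! ### An `L¹` bound for trigonometric polynomials -/

section Kernel

variable {n : ℕ}

lemma integral_one_add_mul_rpow_le {a c : ℝ} (ha : 1 < a) (hc : 0 < c) :
    ∫ s in (0 : ℝ)..1, (1 + c * s) ^ (-a) ≤ 1 / (c * (a - 1)) := by
  rw [intervalIntegral.integral_comp_add_mul (fun s : ℝ => s ^ (-a)) hc.ne', integral_rpow]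
  · have h1 : (1 + c) ^ (-a + 1) ≥ 0 := by positivity
    have h2 : a - 1 > 0 := by linarith
    rw [mul_zero, add_zero, mul_one, Real.one_rpow, smul_eq_mul, ← neg_div_neg_eq, ← div_eq_inv_mul,
      div_div, show -(-a + 1) = a - 1 by ring, mul_comm c]
    gcongr
    linarith
  · right
    refine ⟨by linarith, ?_⟩
    rw [Set.uIcc_of_le (by linarith)]
    exact fun h => by linarith [h.1]

/-- The distance from `e^{-2πis}` to `1`. -/
def circDist (s : ℝ) : ℝ := ‖Complex.exp (-(2 * (π : ℂ) * Complex.I) * (s : ℂ)) - 1‖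

@[fun_prop] lemma continuous_circDist : Continuous circDist := by
  unfold circDist; fun_prop

lemma circDist_nonneg (s : ℝ) : 0 ≤ circDist s := norm_nonneg _

lemma circDist_eq (s : ℝ) : circDist s = 2 * |sin (π * s)| := by
  have h := Complex.norm_exp_I_mul_ofReal_sub_one (-(2 * π * s))
  rw [circDist, show -(2 * (π : ℂ) * Complex.I) * (s : ℂ) =
    Complex.I * ((-(2 * π * s) : ℝ) : ℂ) by push_cast; ring, h, norm_mul, Real.norm_eq_abs,
    Real.norm_eq_abs, abs_of_pos (by norm_num : (0 : ℝ) < 2)]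
  rw [show -(2 * π * s) / 2 = -(π * s) by ring, sin_neg, abs_neg]

lemma le_circDist {s : ℝ} (h0 : 0 ≤ s) (h1 : s ≤ 1) : 4 * s ≤ circDist s ∨ 4 * (1 - s) ≤ circDist s := by
  rw [circDist_eq]
  have hpi := Real.pi_pos
  rcases le_total s (1 / 2) with h | h
  · left
    have := Real.mul_le_sin (x := π * s) (by positivity) (by nlinarith)
    rw [show 2 / π * (π * s) = 2 * s by field_simp] at this
    linarith [le_abs_self (sin (π * s))]
  · right
    have := Real.mul_le_sin (x := π * (1 - s)) (mul_nonneg hpi.le (by linarith)) (by nlinarith)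
    rw [show 2 / π * (π * (1 - s)) = 2 * (1 - s) by field_simp,
      show π * (1 - s) = π - π * s by ring, sin_pi_sub] at this
    linarith [le_abs_self (sin (π * s))]

lemma integral_circDist_le {a R : ℝ} (ha : 1 < a) (hR : 0 < R) :
    ∫ s in Set.Ico (0 : ℝ) 1, (1 + R * circDist s) ^ (-a) ≤ 1 / (2 * (a - 1)) / R := by
  have hpos : ∀ s, 0 < 1 + R * circDist s := fun s => by
    have := circDist_nonneg s
    positivity
  have hcont : Continuous fun s => (1 + R * circDist s) ^ (-a) :=
    Continuous.rpow_const (by fun_prop) fun s => Or.inl (hpos s).ne'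
  have hI : IntervalIntegrable (fun s : ℝ => (1 + 4 * R * s) ^ (-a)) volume 0 1 := by
    refine ContinuousOn.intervalIntegrable fun s hs => ?_
    rw [Set.uIcc_of_le zero_le_one] at hs
    have : (0 : ℝ) < 1 + 4 * R * s := by have := hs.1; positivity
    exact (ContinuousAt.rpow_const (f := fun s : ℝ => 1 + 4 * R * s) (by fun_prop)
      (Or.inl this.ne')).continuousWithinAt
  have hI' : IntervalIntegrable (fun s : ℝ => (1 + 4 * R * (1 - s)) ^ (-a)) volume 0 1 := by
    simpa using (hI.comp_sub_left 1).symm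
  have h4 : 0 < 4 * R := by positivity
  rw [integral_Ico_eq_integral_Ioc, ← intervalIntegral.integral_of_le zero_le_one]
  calc ∫ s in (0 : ℝ)..1, (1 + R * circDist s) ^ (-a)
      ≤ ∫ s in (0 : ℝ)..1, ((1 + 4 * R * s) ^ (-a) + (1 + 4 * R * (1 - s)) ^ (-a)) := by
        refine intervalIntegral.integral_mono_on zero_le_one (hcont.intervalIntegrable _ _)
          (hI.add hI') fun s hs => ?_
        have e1 : (0 : ℝ) < 1 + 4 * R * s := by have := hs.1; positivity
        have e2 : (0 : ℝ) < 1 + 4 * R * (1 - s) := by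
          have := sub_nonneg.2 hs.2; positivity
        rcases le_circDist hs.1 hs.2 with h | h
        · refine le_add_of_le_of_nonneg ?_ (by positivity)
          exact Real.rpow_le_rpow_of_nonpos e1 (by nlinarith) (by linarith)
        · refine le_add_of_nonneg_of_le (by positivity) ?_
          exact Real.rpow_le_rpow_of_nonpos e2 (by nlinarith) (by linarith)
    _ = (∫ s in (0 : ℝ)..1, (1 + 4 * R * s) ^ (-a)) + ∫ s in (0 : ℝ)..1, (1 + 4 * R * s) ^ (-a) := by
        rw [intervalIntegral.integral_add hI hI',
          intervalIntegral.integral_comp_sub_left (fun s => (1 + 4 * R * s) ^ (-a))]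
        simp
    _ ≤ 1 / (4 * R * (a - 1)) + 1 / (4 * R * (a - 1)) := by
        gcongr <;> exact integral_one_add_mul_rpow_le ha h4
    _ = 1 / (2 * (a - 1)) / R := by
        have : a - 1 ≠ 0 := by linarith
        field_simp
        norm_num

lemma norm_eChar_sub_one (x : Fin n → ℝ) (j : Fin n) :
    ‖eChar x (-Pi.single j 1) - 1‖ = circDist (x j) := by
  rw [circDist, eChar]
  congr 3
  rw [Finset.sum_eq_single j]
  · simp
  · intro i _ hi
    simp [hi]
  · simp

/-- A weight growing like the `2N`-th power of the distance to the lattice at scale `R⁻¹`. -/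
def wgt (N : ℕ) (R : ℝ) (x : Fin n → ℝ) : ℝ := 1 + ∑ j, (R * circDist (x j)) ^ (2 * N)

@[fun_prop] lemma continuous_wgt (N : ℕ) (R : ℝ) : Continuous (wgt (n := n) N R) := by
  unfold wgt; fun_prop

lemma one_le_wgt (N : ℕ) (R : ℝ) (x : Fin n → ℝ) : 1 ≤ wgt N R x :=
  le_add_of_nonneg_right (Finset.sum_nonneg fun _ _ => (even_two_mul N).pow_nonneg _)

lemma prod_one_add_rpow_le (hn : 1 ≤ n) (N : ℕ) {R : ℝ} (hR : 0 < R) (x : Fin n → ℝ) :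
    ∏ j, (1 + R * circDist (x j)) ^ (2 * N / n : ℝ) ≤ 4 ^ N * wgt N R x := by
  have hW : 0 ≤ 4 ^ N * wgt N R x := by have := one_le_wgt N R x; positivity
  have h1 : ∀ j, (1 + R * circDist (x j)) ^ (2 * N / n : ℝ) ≤ (4 ^ N * wgt N R x) ^ (1 / n : ℝ) := by
    intro j
    have ht : 0 ≤ R * circDist (x j) := mul_nonneg hR.le (circDist_nonneg _)
    rw [show (2 * N / n : ℝ) = ((2 * N : ℕ) : ℝ) * (1 / n : ℝ) by push_cast; ring,
      Real.rpow_mul (by positivity), Real.rpow_natCast]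
    refine Real.rpow_le_rpow (by positivity) ?_ (by positivity)
    have h2 : (R * circDist (x j)) ^ (2 * N) ≤ ∑ j, (R * circDist (x j)) ^ (2 * N) :=
      Finset.single_le_sum (f := fun j => (R * circDist (x j)) ^ (2 * N))
        (fun _ _ => (even_two_mul N).pow_nonneg _) (Finset.mem_univ j)
    have h3 : 0 ≤ ∑ j, (R * circDist (x j)) ^ (2 * N) := (pow_nonneg ht _).trans h2
    rw [show (4 : ℝ) ^ N = 2 ^ (2 * N) by rw [pow_mul]; norm_num]
    rcases le_total (R * circDist (x j)) 1 with h | h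
    · calc (1 + R * circDist (x j)) ^ (2 * N) ≤ 2 ^ (2 * N) := by gcongr; linarith
        _ ≤ _ := le_mul_of_one_le_right (by positivity) (one_le_wgt N R x)
    · calc (1 + R * circDist (x j)) ^ (2 * N) ≤ (2 * (R * circDist (x j))) ^ (2 * N) := by
            gcongr; linarith
        _ = 2 ^ (2 * N) * (R * circDist (x j)) ^ (2 * N) := mul_pow _ _ _
        _ ≤ _ := by gcongr; rw [wgt]; linarith
  calc ∏ j, (1 + R * circDist (x j)) ^ (2 * N / n : ℝ)
      ≤ ∏ _j : Fin n, (4 ^ N * wgt N R x) ^ (1 / n : ℝ) :=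
        Finset.prod_le_prod (fun j _ => by
          have := circDist_nonneg (x j)
          positivity) fun j _ => h1 j
    _ = 4 ^ N * wgt N R x := by
        rw [Finset.prod_const, Finset.card_univ, Fintype.card_fin, ← Real.rpow_natCast,
          ← Real.rpow_mul hW, one_div_mul_cancel (by positivity), Real.rpow_one]

lemma integral_inv_wgt_le (hn : 1 ≤ n) {N : ℕ} (hN : n < 2 * N) {R : ℝ} (hR : 0 < R) :
    ∫ x, (wgt N R x)⁻¹ ∂(μT n) ≤ 4 ^ N * (1 / (2 * (2 * N / n - 1)) / R) ^ n := by
  have ha : (1 : ℝ) < 2 * N / n := by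
    rw [one_lt_div (by positivity)]; exact_mod_cast hN
  have hpos : ∀ s, 0 < 1 + R * circDist s := fun s => by
    have := circDist_nonneg s
    positivity
  have hcont : Continuous fun s => (1 + R * circDist s) ^ (-(2 * N / n : ℝ)) :=
    Continuous.rpow_const (by fun_prop) fun s => Or.inl (hpos s).ne'
  calc ∫ x, (wgt N R x)⁻¹ ∂(μT n)
      ≤ ∫ x, 4 ^ N * ∏ j, (1 + R * circDist (x j)) ^ (-(2 * N / n : ℝ)) ∂(μT n) := by
        refine integral_mono (integrable_μT_of_continuous
          (Continuous.inv₀ (by fun_prop) fun x => (by linarith [one_le_wgt N R x])))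
          (integrable_μT_of_continuous ?_) fun x => ?_
        · exact continuous_const.mul (continuous_finsetProd _ fun j _ =>
            hcont.comp (continuous_apply j))
        · have h1 := prod_one_add_rpow_le hn N hR x
          have h2 : 0 < ∏ j, (1 + R * circDist (x j)) ^ (2 * N / n : ℝ) :=
            Finset.prod_pos fun j _ => Real.rpow_pos_of_pos (hpos _) _
          simp_rw [Real.rpow_neg (hpos _).le, Finset.prod_inv_distrib]
          rw [← div_eq_mul_inv, inv_eq_one_div, div_le_div_iff₀ (by linarith [one_le_wgt N R x]) h2]
          linarith
    _ = 4 ^ N * (∫ s in Set.Ico (0 : ℝ) 1, (1 + R * circDist s) ^ (-(2 * N / n : ℝ))) ^ n := by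
        rw [integral_const_mul, μT_eq_pi,
          integral_fintype_prod_eq_pow (f := fun s => (1 + R * circDist s) ^ (-(2 * N / n : ℝ))),
          Fintype.card_fin]
    _ ≤ _ := by
        gcongr
        · exact integral_nonneg fun s => Real.rpow_nonneg (hpos s).le _
        · exact integral_circDist_le ha hR

lemma integral_wgt_mul_norm_trig_sq_le {N : ℕ} {R B : ℝ} (hR : 0 < R)
    {a : (Fin n → ℤ) → ℂ} {S : Finset (Fin n → ℤ)} (ha : ∀ ξ ∉ S, a ξ = 0)
    (had : ∀ j, ∀ ξ ∉ S, (dd j)^[N] a ξ = 0) (haB : ∀ ξ, ‖a ξ‖ ≤ B)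
    (hdB : ∀ j ξ, ‖(dd j)^[N] a ξ‖ * R ^ N ≤ B) :
    ∫ x, wgt N R x * ‖trig a x‖ ^ 2 ∂(μT n) ≤ (n + 1) * (S.card * B ^ 2) := by
  have hc := continuous_trig ha
  have h1 : ∀ x, wgt N R x * ‖trig a x‖ ^ 2 =
      ‖trig a x‖ ^ 2 + ∑ j, (R ^ N) ^ 2 * ‖trig ((dd j)^[N] a) x‖ ^ 2 := by
    intro x
    rw [wgt, add_mul, one_mul, Finset.sum_mul]
    congr 1
    refine Finset.sum_congr rfl fun j _ => ?_
    rw [trig_iterate_dd (finite_support_of_eq_zero ha), norm_mul, norm_pow, norm_eChar_sub_one]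
    ring
  simp_rw [h1]
  rw [integral_add (integrable_μT_of_continuous (by fun_prop))
    (integrable_finsetSum _ fun j _ => integrable_μT_of_continuous
      (by have := continuous_trig (had j); fun_prop)),
    integral_finsetSum _ fun j _ => integrable_μT_of_continuous
      (by have := continuous_trig (had j); fun_prop), integral_norm_trig_sq ha]
  have h2 : ∀ j, ∫ x, (R ^ N) ^ 2 * ‖trig ((dd j)^[N] a) x‖ ^ 2 ∂(μT n) ≤ S.card * B ^ 2 := by
    intro j
    rw [integral_const_mul, integral_norm_trig_sq (had j), Finset.mul_sum, ← nsmul_eq_mul]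
    refine Finset.sum_le_card_nsmul _ _ _ fun ξ _ => ?_
    rw [← mul_pow, mul_comm]
    exact pow_le_pow_left₀ (by positivity) (hdB j ξ) 2
  have h3 : ∑ ξ ∈ S, ‖a ξ‖ ^ 2 ≤ S.card * B ^ 2 := by
    rw [← nsmul_eq_mul]
    exact Finset.sum_le_card_nsmul _ _ _ fun ξ _ =>
      pow_le_pow_left₀ (norm_nonneg _) (haB ξ) 2
  have h4 := Finset.sum_le_card_nsmul Finset.univ _ _ fun j _ => h2 j
  rw [Finset.card_univ, Fintype.card_fin, nsmul_eq_mul] at h4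
  linarith

/-- The constant in `integral_norm_trig_le`. -/
def kerConst (n N : ℕ) : ℝ := (n + 1) + 4 ^ N * (1 / (2 * (2 * N / n - 1))) ^ n

lemma integral_norm_trig_le (hn : 1 ≤ n) {N : ℕ} (hN : n < 2 * N) {R B b : ℝ} (hR : 0 < R)
    (hb : 0 < b)
    {a : (Fin n → ℤ) → ℂ} {S : Finset (Fin n → ℤ)} (ha : ∀ ξ ∉ S, a ξ = 0)
    (had : ∀ j, ∀ ξ ∉ S, (dd j)^[N] a ξ = 0) (haB : ∀ ξ, ‖a ξ‖ ≤ B)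
    (hdB : ∀ j ξ, ‖(dd j)^[N] a ξ‖ * R ^ N ≤ B) (hS : S.card * B ^ 2 ≤ b ^ 2 * R ^ n) :
    ∫ x, ‖trig a x‖ ∂(μT n) ≤ kerConst n N * b := by
  have hc := continuous_trig ha
  have hW := fun x => one_le_wgt (n := n) N R x
  set l : ℝ := (R ^ n)⁻¹ / b with hl
  have hl0 : 0 < l := by positivity
  have i1 : Integrable (fun x => wgt N R x * ‖trig a x‖ ^ 2) (μT n) :=
    integrable_μT_of_continuous (by fun_prop)
  have i2 : Integrable (fun x => (wgt N R x)⁻¹) (μT n) := integrable_μT_of_continuous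
    (Continuous.inv₀ (by fun_prop) fun x => (by linarith [hW x]))
  have hQ := integral_inv_wgt_le hn hN hR
  have hP := integral_wgt_mul_norm_trig_sq_le hR ha had haB hdB
  calc ∫ x, ‖trig a x‖ ∂(μT n)
      ≤ ∫ x, (l * (wgt N R x * ‖trig a x‖ ^ 2) + l⁻¹ * (wgt N R x)⁻¹) ∂(μT n) := by
        refine integral_mono (integrable_μT_of_continuous (by fun_prop))
          ((i1.const_mul _).add (i2.const_mul _)) fun x => ?_
        have hw : 0 < l * wgt N R x := mul_pos hl0 (by linarith [hW x])
        set y := l * wgt N R x with hy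
        show ‖trig a x‖ ≤ l * (wgt N R x * ‖trig a x‖ ^ 2) + l⁻¹ * (wgt N R x)⁻¹
        rw [← mul_assoc, ← mul_inv, ← hy, ← div_one (‖trig a x‖), inv_eq_one_div, ← sub_nonneg]
        have : y * (‖trig a x‖ / 1) ^ 2 + 1 / y - ‖trig a x‖ / 1 =
          ((y * ‖trig a x‖ - 1 / 2) ^ 2 + 3 / 4) / y := by field_simp; ring
        rw [this]
        positivity
    _ = l * (∫ x, wgt N R x * ‖trig a x‖ ^ 2 ∂(μT n)) + l⁻¹ * ∫ x, (wgt N R x)⁻¹ ∂(μT n) := by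
        rw [integral_add (i1.const_mul _) (i2.const_mul _), integral_const_mul, integral_const_mul]
    _ ≤ l * ((n + 1) * (b ^ 2 * R ^ n)) +
          l⁻¹ * (4 ^ N * (1 / (2 * (2 * N / n - 1)) / R) ^ n) := by
        gcongr
        exact hP.trans (by gcongr)
    _ = kerConst n N * b := by
        rw [kerConst, hl, div_pow]
        field_simp

end Kernel

/-! ### Convolution with trigonometric polynomials -/

section Young

variable {n : ℕ}

lemma fc_eq_integral_eChar (f : (Fin n → ℝ) → ℂ) (ξ : Fin n → ℤ) :
    fc f ξ = ∫ y, eChar (-y) ξ * f y ∂(μT n) := by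
  simp only [fc, eChar, Pi.neg_apply, Complex.ofReal_neg, neg_mul, Finset.sum_neg_distrib, mul_neg]

lemma trig_mul_fc {a : (Fin n → ℤ) → ℂ} {S : Finset (Fin n → ℤ)} (ha : ∀ ξ ∉ S, a ξ = 0)
    {f : (Fin n → ℝ) → ℂ} (hf : Continuous f) (x : Fin n → ℝ) :
    trig (fun ξ => a ξ * fc f ξ) x = ∫ y, trig a (x - y) * f y ∂(μT n) := by
  rw [trig_eq_sum (S := S) fun ξ hξ => by rw [ha ξ hξ, zero_mul]]
  simp_rw [trig_eq_sum ha, Finset.sum_mul]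
  rw [integral_finsetSum _ fun ξ _ => integrable_μT_of_continuous (by fun_prop)]
  refine Finset.sum_congr rfl fun ξ _ => ?_
  rw [fc_eq_integral_eChar, ← mul_assoc, ← integral_const_mul]
  congr 1
  funext y
  rw [sub_eq_add_neg, eChar_add_left]
  ring

lemma lintegral_mul_rpow_le {α : Type*} [MeasurableSpace α] {μ : Measure α} {p : ℝ} (hp : 1 ≤ p)
    {k g : α → ℝ≥0∞} (hk : Measurable k) (hg : Measurable g) :
    (∫⁻ y, k y * g y ∂μ) ^ p ≤ (∫⁻ y, k y * g y ^ p ∂μ) * (∫⁻ y, k y ∂μ) ^ (p - 1) := by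
  have hp0 : 0 < p := by linarith
  have h := eLpNorm'_le_eLpNorm'_mul_rpow_measure_univ (μ := μ.withDensity k) (f := g)
    one_pos hp hg.aestronglyMeasurable
  simp only [eLpNorm', ENNReal.rpow_one, div_one, enorm_eq_self] at h
  rw [lintegral_withDensity_eq_lintegral_mul _ hk hg,
    lintegral_withDensity_eq_lintegral_mul _ hk (hg.pow_const p),
    withDensity_apply _ MeasurableSet.univ, Measure.restrict_univ] at h
  calc (∫⁻ y, k y * g y ∂μ) ^ p
      ≤ ((∫⁻ y, k y * g y ^ p ∂μ) ^ (1 / p) * (∫⁻ y, k y ∂μ) ^ (1 - 1 / p)) ^ p := by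
        gcongr
        simpa using h
    _ = _ := by
        rw [ENNReal.mul_rpow_of_nonneg _ _ hp0.le, ← ENNReal.rpow_mul, ← ENNReal.rpow_mul,
          one_div_mul_cancel hp0.ne', ENNReal.rpow_one, sub_mul, one_mul, one_div_mul_cancel hp0.ne']

lemma lintegral_enorm_trig_mul_fc_rpow_le {p : ℝ} (hp : 1 ≤ p) {a : (Fin n → ℤ) → ℂ}
    {S : Finset (Fin n → ℤ)} (ha : ∀ ξ ∉ S, a ξ = 0)
    {f : (Fin n → ℝ) → ℂ} (hf : Continuous f) :
    ∫⁻ x, ‖trig (fun ξ => a ξ * fc f ξ) x‖ₑ ^ p ∂(μT n) ≤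
      (∫⁻ x, ‖trig a x‖ₑ ∂(μT n)) ^ p * ∫⁻ x, ‖f x‖ₑ ^ p ∂(μT n) := by
  have hc := continuous_trig ha
  have hper : ∀ (x : Fin n → ℝ) (v : Fin n → ℤ),
      ‖trig a (x + fun j => (v j : ℝ))‖ₑ = ‖trig a x‖ₑ := fun x v => by rw [trig_add_intCast]
  set κ := ∫⁻ x, ‖trig a x‖ₑ ∂(μT n) with hκ
  have h1 : ∀ x, ‖trig (fun ξ => a ξ * fc f ξ) x‖ₑ ^ p ≤
      (∫⁻ y, ‖trig a (x - y)‖ₑ * ‖f y‖ₑ ^ p ∂(μT n)) * κ ^ (p - 1) := by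
    intro x
    rw [hκ, ← lintegral_μT_sub_left (g := fun y => ‖trig a y‖ₑ) hper x, trig_mul_fc ha hf]
    refine le_trans ?_ (lintegral_mul_rpow_le hp
      (show Continuous fun y => ‖trig a (x - y)‖ₑ by fun_prop).measurable (by fun_prop))
    gcongr
    refine (enorm_integral_le_lintegral_enorm _).trans_eq ?_
    simp_rw [enorm_mul]
  calc ∫⁻ x, ‖trig (fun ξ => a ξ * fc f ξ) x‖ₑ ^ p ∂(μT n)
      ≤ ∫⁻ x, (∫⁻ y, ‖trig a (x - y)‖ₑ * ‖f y‖ₑ ^ p ∂(μT n)) * κ ^ (p - 1) ∂(μT n) :=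
        lintegral_mono h1
    _ = (∫⁻ x, (∫⁻ y, ‖trig a (x - y)‖ₑ * ‖f y‖ₑ ^ p ∂(μT n)) ∂(μT n)) * κ ^ (p - 1) :=
        lintegral_mul_const _ (Measurable.lintegral_prod_right'
          (f := fun z : (Fin n → ℝ) × (Fin n → ℝ) => ‖trig a (z.1 - z.2)‖ₑ * ‖f z.2‖ₑ ^ p)
          (by fun_prop))
    _ = (∫⁻ y, (∫⁻ x, ‖trig a (x - y)‖ₑ * ‖f y‖ₑ ^ p ∂(μT n)) ∂(μT n)) * κ ^ (p - 1) := by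
        rw [lintegral_lintegral_swap]
        exact Measurable.aemeasurable (by unfold Function.uncurry; fun_prop)
    _ = (∫⁻ y, κ * ‖f y‖ₑ ^ p ∂(μT n)) * κ ^ (p - 1) := by
        congr 1
        refine lintegral_congr fun y => ?_
        rw [lintegral_mul_const _
          (show Continuous fun x => ‖trig a (x - y)‖ₑ by fun_prop).measurable]
        simp_rw [sub_eq_add_neg]
        rw [lintegral_μT_add_right (g := fun y => ‖trig a y‖ₑ) hper]
    _ = κ ^ p * ∫⁻ x, ‖f x‖ₑ ^ p ∂(μT n) := by
        rw [lintegral_const_mul _ (by fun_prop), mul_right_comm]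
        congr 1
        nth_rw 1 [← ENNReal.rpow_one κ]
        rw [← ENNReal.rpow_add_of_nonneg _ _ zero_le_one (by linarith)]
        congr 1
        ring

end Young

/-! ### Difference calculus and dyadic cutoffs -/

section Cutoff

variable {n : ℕ}

lemma dd_add (j : Fin n) (a b : (Fin n → ℤ) → ℂ) : dd j (a + b) = dd j a + dd j b := by
  funext ξ; simp only [dd, Pi.add_apply]; ring

lemma iterate_dd_add (j : Fin n) (m : ℕ) (a b : (Fin n → ℤ) → ℂ) :
    (dd j)^[m] (a + b) = (dd j)^[m] a + (dd j)^[m] b := by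
  induction m generalizing a b with
  | zero => rfl
  | succ m ih => rw [Function.iterate_succ_apply, dd_add, ih]; rfl

lemma dd_sub (j : Fin n) (a b : (Fin n → ℤ) → ℂ) : dd j (a - b) = dd j a - dd j b := by
  funext ξ; simp only [dd, Pi.sub_apply]; ring

lemma iterate_dd_sub (j : Fin n) (m : ℕ) (a b : (Fin n → ℤ) → ℂ) :
    (dd j)^[m] (a - b) = (dd j)^[m] a - (dd j)^[m] b := by
  induction m generalizing a b with
  | zero => rfl
  | succ m ih => rw [Function.iterate_succ_apply, dd_sub, ih]; rfl

lemma iterate_dd_comp_add (j : Fin n) (m : ℕ) (a : (Fin n → ℤ) → ℂ) (v : Fin n → ℤ) :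
    (dd j)^[m] (fun ξ => a (ξ + v)) = fun ξ => (dd j)^[m] a (ξ + v) := by
  induction m generalizing a with
  | zero => rfl
  | succ m ih =>
    rw [Function.iterate_succ_apply, Function.iterate_succ_apply, ← ih]
    congr 1
    funext ξ
    simp only [dd, add_right_comm]

lemma dd_mul (j : Fin n) (s φ : (Fin n → ℤ) → ℂ) :
    dd j (s * φ) = dd j s * (fun ξ => φ (ξ + Pi.single j 1)) + s * dd j φ := by
  funext ξ; simp only [dd, Pi.add_apply, Pi.mul_apply]; ring

lemma norm_iterate_dd_mul_le (j : Fin n) (m : ℕ) {s φ : (Fin n → ℤ) → ℂ} {ξ : Fin n → ℤ} {B : ℝ}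
    (h : ∀ i l q : ℕ, i + l = m → q ≤ m →
      ‖(dd j)^[i] s ξ‖ * ‖(dd j)^[l] φ (ξ + q • Pi.single j 1)‖ ≤ B) :
    ‖(dd j)^[m] (s * φ) ξ‖ ≤ 2 ^ m * B := by
  induction m generalizing s φ with
  | zero => simpa using h 0 0 0 rfl le_rfl
  | succ m ih =>
    rw [Function.iterate_succ_apply, dd_mul, iterate_dd_add, Pi.add_apply]
    have h1 := ih (s := dd j s) (φ := fun ξ => φ (ξ + Pi.single j 1)) fun i l q hil hq => by
      have := h (i + 1) l (q + 1) (by omega) (by omega)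
      rw [Function.iterate_succ_apply] at this
      rw [iterate_dd_comp_add]
      simpa only [succ_nsmul, ← add_assoc] using this
    have h2 := ih (s := s) (φ := dd j φ) fun i l q hil hq => by
      have := h i (l + 1) q (by omega) (by omega)
      rwa [Function.iterate_succ_apply] at this
    calc _ ≤ _ := norm_add_le _ _
      _ ≤ 2 ^ m * B + 2 ^ m * B := add_le_add h1 h2
      _ = 2 ^ (m + 1) * B := by ring

lemma iterate_dd_eq_zero (j : Fin n) (m : ℕ) {a : (Fin n → ℤ) → ℂ} {ξ : Fin n → ℤ}
    (h : ∀ q : ℕ, q ≤ m → a (ξ + q • Pi.single j 1) = 0) : (dd j)^[m] a ξ = 0 := by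
  induction m generalizing a with
  | zero => simpa using h 0 le_rfl
  | succ m ih =>
    rw [Function.iterate_succ_apply]
    refine ih fun q hq => ?_
    have h1 := h (q + 1) (by omega)
    rw [succ_nsmul, ← add_assoc] at h1
    rw [dd, h1, h q (by omega), sub_zero]

lemma norm_iterate_fwdDiff_le (m : ℕ) {g : ℝ → ℝ} (hg : ContDiff ℝ (⊤ : ℕ∞) g) {M h : ℝ}
    (hh : 0 ≤ h) (hM : ∀ t, |iteratedDeriv m g t| ≤ M) (t : ℝ) :
    |(fwdDiff h)^[m] g t| ≤ M * h ^ m := by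
  induction m generalizing g M with
  | zero => simpa using hM t
  | succ m ih =>
    have hs : ContDiff ℝ (⊤ : ℕ∞) fun t => g (t + h) := hg.comp (by fun_prop)
    have hd : ∀ t, HasDerivAt (iteratedDeriv m g) (iteratedDeriv (m + 1) g t) t := fun t => by
      rw [iteratedDeriv_succ]
      exact ((hg.differentiable_iteratedDeriv m (by exact_mod_cast WithTop.coe_lt_top m)) t).hasDerivAt
    rw [Function.iterate_succ_apply, pow_succ', ← mul_assoc]
    refine ih (hs.sub hg) fun t => ?_
    have h1 : iteratedDeriv m (fun x => g (x + h) - g x) t = iteratedDeriv m g (t + h) - iteratedDeriv m g t := by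
      rw [← congrFun (iteratedDeriv_comp_add_const m g h) t]
      exact iteratedDeriv_sub (hs.contDiffAt.of_le (by exact_mod_cast le_top))
        (hg.contDiffAt.of_le (by exact_mod_cast le_top))
    rw [h1]
    have := Convex.norm_image_sub_le_of_norm_hasDerivWithin_le (f := iteratedDeriv m g)
      (s := Set.univ) (x := t) (y := t + h) (C := M) (fun s _ => (hd s).hasDerivWithinAt)
      (fun s _ => hM s) convex_univ trivial trivial
    rwa [add_sub_cancel_left, Real.norm_eq_abs, Real.norm_eq_abs, abs_of_nonneg hh] at this

lemma iterate_dd_coord_mul (j : Fin n) (m : ℕ) (g : ℝ → ℝ) (h : ℝ) {G : (Fin n → ℤ) → ℂ}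
    (hG : ∀ ξ, G (ξ + Pi.single j 1) = G ξ) :
    (dd j)^[m] (fun ξ => (g (ξ j * h) : ℂ) * G ξ) =
      fun ξ => (((fwdDiff h)^[m] g (ξ j * h) : ℝ) : ℂ) * G ξ := by
  induction m generalizing g with
  | zero => rfl
  | succ m ih =>
    rw [Function.iterate_succ_apply, Function.iterate_succ_apply, ← ih]
    congr 1
    funext ξ
    simp only [dd, hG, fwdDiff, Pi.add_apply, Pi.single_eq_same, Int.cast_add, Int.cast_one,
      add_mul, one_mul, Complex.ofReal_sub]
    ring

/-- A smooth bump on `ℝ`, equal to `1` on `[-1, 1]` and vanishing off `(-2, 2)`. -/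
def bump : ContDiffBump (0 : ℝ) := ⟨1, 2, one_pos, one_lt_two⟩

lemma bump_eq_one {t : ℝ} (h : |t| ≤ 1) : bump t = 1 :=
  bump.one_of_mem_closedBall (by simpa [bump] using h)

lemma bump_eq_zero {t : ℝ} (h : 2 ≤ |t|) : bump t = 0 :=
  bump.zero_of_le_dist (by simpa [bump] using h)

lemma exists_abs_iteratedDeriv_bump_le (m : ℕ) : ∃ M, ∀ t, |iteratedDeriv m bump t| ≤ M := by
  have h1 : Continuous (iteratedDeriv m bump) :=
    (bump.contDiff (n := (⊤ : ℕ∞))).continuous_iteratedDeriv m (by exact_mod_cast le_top)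
  refine h1.bounded_above_of_compact_support ?_
  clear h1
  induction m with
  | zero => simpa using bump.hasCompactSupport
  | succ m ih => rw [iteratedDeriv_succ]; exact ih.deriv

/-- A smooth cutoff to the frequencies `|ξ| ≲ 2 ^ k`, shifted by one so that it vanishes for
`k = 0`. -/
def lowCut : ℕ → (Fin n → ℤ) → ℂ
  | 0 => 0
  | k + 1 => fun ξ => ∏ i, (bump (ξ i * (2 ^ k)⁻¹) : ℂ)

/-- A smooth cutoff to the frequencies `|ξ| ∼ 2 ^ k`. -/
def dyCut (k : ℕ) : (Fin n → ℤ) → ℂ := lowCut (k + 1) - lowCut k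

lemma sum_dyCut (K : ℕ) (ξ : Fin n → ℤ) : ∑ k ∈ Finset.range K, dyCut k ξ = lowCut K ξ := by
  simpa [dyCut, lowCut] using Finset.sum_range_sub (fun k => lowCut k ξ) K

lemma norm_lowCut_le (k : ℕ) (ξ : Fin n → ℤ) : ‖lowCut k ξ‖ ≤ 1 := by
  cases k with
  | zero => simp [lowCut]
  | succ k =>
    rw [lowCut, norm_prod]
    refine Finset.prod_le_one (fun _ _ => norm_nonneg _) fun i _ => ?_
    rw [Complex.norm_real, Real.norm_eq_abs, abs_of_nonneg bump.nonneg]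
    exact bump.le_one

lemma lowCut_eq_one {k : ℕ} {ξ : Fin n → ℤ} (h : ∀ i, |(ξ i : ℝ)| ≤ 2 ^ k) :
    lowCut (k + 1) ξ = 1 := by
  refine Finset.prod_eq_one fun i _ => ?_
  rw [bump_eq_one, Complex.ofReal_one]
  rw [abs_mul, abs_inv, abs_of_pos (by positivity : (0 : ℝ) < 2 ^ k), ← div_eq_mul_inv,
    div_le_one (by positivity)]
  exact h i

lemma abs_le_of_lowCut_ne_zero {k : ℕ} {ξ : Fin n → ℤ} (h : lowCut (k + 1) ξ ≠ 0) (i : Fin n) :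
    |(ξ i : ℝ)| ≤ 2 ^ (k + 1) := by
  by_contra! hi
  refine h (Finset.prod_eq_zero (Finset.mem_univ i) ?_)
  rw [bump_eq_zero, Complex.ofReal_zero]
  rw [abs_mul, abs_inv, abs_of_pos (by positivity : (0 : ℝ) < 2 ^ k), ← div_eq_mul_inv,
    le_div_iff₀ (by positivity)]
  rw [pow_succ'] at hi
  exact hi.le

lemma one_le_jb (ξ : Fin n → ℤ) : 1 ≤ jb ξ := by
  rw [jb, Real.one_le_sqrt]
  exact le_add_of_nonneg_right (Finset.sum_nonneg fun _ _ => sq_nonneg _)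

lemma abs_le_jb (ξ : Fin n → ℤ) (i : Fin n) : |(ξ i : ℝ)| ≤ jb ξ := by
  refine Real.abs_le_sqrt ?_
  have := Finset.single_le_sum (f := fun i => ((ξ i : ℝ)) ^ 2) (fun _ _ => sq_nonneg _)
    (Finset.mem_univ i)
  linarith

lemma jb_add_single_le (ξ : Fin n → ℤ) (j : Fin n) : jb (ξ + Pi.single j 1) ≤ 2 * jb ξ := by
  rw [jb, jb, Real.sqrt_le_left (by positivity), mul_pow, Real.sq_sqrt (by positivity)]
  have h : ∀ i, (((ξ + Pi.single j 1 : Fin n → ℤ) i : ℤ) : ℝ) ^ 2 ≤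
      2 * (ξ i : ℝ) ^ 2 + if i = j then 2 else 0 := by
    intro i
    rcases eq_or_ne i j with rfl | hi
    · simp only [Pi.add_apply, Pi.single_eq_same, Int.cast_add, Int.cast_one, if_true]
      nlinarith [sq_nonneg ((ξ i : ℝ) - 1)]
    · simp only [Pi.add_apply, Pi.single_eq_of_ne hi, add_zero, if_neg hi]
      nlinarith [sq_nonneg (ξ i : ℝ)]
  have h1 := Finset.sum_le_sum fun i (_ : i ∈ Finset.univ) => h i
  rw [Finset.sum_add_distrib, ← Finset.mul_sum, Finset.sum_ite_eq', if_pos (Finset.mem_univ j)]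
    at h1
  have h2 : 0 ≤ ∑ i, (ξ i : ℝ) ^ 2 := Finset.sum_nonneg fun _ _ => sq_nonneg _
  linarith

lemma jb_add_nsmul_single_le (ξ : Fin n → ℤ) (j : Fin n) (q : ℕ) :
    jb (ξ + q • Pi.single j 1) ≤ 2 ^ q * jb ξ := by
  induction q with
  | zero => simp
  | succ q ih =>
    rw [succ_nsmul, ← add_assoc]
    calc _ ≤ _ := jb_add_single_le _ j
      _ ≤ 2 * (2 ^ q * jb ξ) := by gcongr
      _ = _ := by ring

lemma abs_le_of_dyCut_ne_zero {k : ℕ} {ξ : Fin n → ℤ} (h : dyCut k ξ ≠ 0) (i : Fin n) :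
    |(ξ i : ℝ)| ≤ 2 ^ (k + 1) := by
  by_cases h1 : lowCut (k + 1) ξ = 0
  · cases k with
    | zero => exact (h (by rw [dyCut, Pi.sub_apply, h1]; simp [lowCut])).elim
    | succ k =>
      have h2 : lowCut (k + 1) ξ ≠ 0 := by
        intro h2
        exact h (by rw [dyCut, Pi.sub_apply, h1, h2, sub_zero])
      exact (abs_le_of_lowCut_ne_zero h2 i).trans (pow_le_pow_right₀ one_le_two (by omega))
  · exact abs_le_of_lowCut_ne_zero h1 i

lemma le_jb_of_dyCut_ne_zero {k : ℕ} {ξ : Fin n → ℤ} (h : dyCut k ξ ≠ 0) :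
    2 ^ k ≤ 2 * jb ξ := by
  cases k with
  | zero => linarith [one_le_jb ξ, pow_zero (2 : ℝ)]
  | succ k =>
    by_contra! h1
    rw [pow_succ'] at h1
    have h2 : ∀ i, |(ξ i : ℝ)| ≤ 2 ^ k := fun i => (abs_le_jb ξ i).trans (by linarith)
    refine h ?_
    rw [dyCut, Pi.sub_apply, lowCut_eq_one h2, lowCut_eq_one fun i => (h2 i).trans
      (pow_le_pow_right₀ one_le_two (by omega)), sub_self]

lemma iterate_dd_zero (j : Fin n) (m : ℕ) : (dd j)^[m] (0 : (Fin n → ℤ) → ℂ) = 0 := by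
  funext ξ; exact iterate_dd_eq_zero j m fun _ _ => rfl

lemma norm_iterate_dd_lowCut_le (j : Fin n) {m : ℕ} {M : ℝ}
    (hM : ∀ t, |iteratedDeriv m bump t| ≤ M) (k : ℕ) (ξ : Fin n → ℤ) :
    ‖(dd j)^[m] (lowCut (k + 1)) ξ‖ ≤ M * ((2 ^ k)⁻¹) ^ m := by
  have h1 : lowCut (k + 1) = fun ξ : Fin n → ℤ => (bump (ξ j * (2 ^ k)⁻¹) : ℂ) *
      ∏ i ∈ Finset.univ.erase j, (bump (ξ i * (2 ^ k)⁻¹) : ℂ) :=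
    funext fun ξ => (Finset.mul_prod_erase _ _ (Finset.mem_univ j)).symm
  rw [h1, iterate_dd_coord_mul j m bump, norm_mul, Complex.norm_real, Real.norm_eq_abs]
  · refine (mul_le_of_le_one_right (abs_nonneg _) ?_).trans
      (norm_iterate_fwdDiff_le m bump.contDiff (by positivity) hM _)
    rw [norm_prod]
    refine Finset.prod_le_one (fun _ _ => norm_nonneg _) fun i _ => ?_
    rw [Complex.norm_real, Real.norm_eq_abs, abs_of_nonneg bump.nonneg]
    exact bump.le_one
  · intro ξ
    refine Finset.prod_congr rfl fun i hi => ?_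
    rw [Pi.add_apply, Pi.single_eq_of_ne (Finset.ne_of_mem_erase hi), add_zero]

lemma exists_norm_iterate_dd_dyCut_le (n m : ℕ) : ∃ M : ℝ, 0 ≤ M ∧ ∀ (j : Fin n) (k : ℕ)
    (ξ : Fin n → ℤ), ‖(dd j)^[m] (dyCut k) ξ‖ ≤ M * ((2 ^ k)⁻¹) ^ m := by
  obtain ⟨M, hM⟩ := exists_abs_iteratedDeriv_bump_le m
  have hM0 : 0 ≤ M := (abs_nonneg _).trans (hM 0)
  refine ⟨M + 2 ^ m * M, by positivity, fun j k ξ => ?_⟩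
  rw [dyCut, iterate_dd_sub, Pi.sub_apply, add_mul]
  refine (norm_sub_le _ _).trans (add_le_add (norm_iterate_dd_lowCut_le j hM k ξ) ?_)
  cases k with
  | zero => rw [lowCut, iterate_dd_zero]; simp; positivity
  | succ k =>
    refine (norm_iterate_dd_lowCut_le j hM k ξ).trans_eq ?_
    rw [mul_right_comm, ← mul_pow, pow_succ' (2 : ℝ) k, mul_inv, mul_inv_cancel_left₀ two_ne_zero,
      mul_comm]

end Cutoff

/-! ### Dyadic pieces of a symbol -/

section Dyadic

variable {n : ℕ}

lemma foldr_pd_iterate_dd {σ : (Fin n → ℝ) → (Fin n → ℤ) → ℂ}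
    (hσ : ∀ ξ, ContDiff ℝ (⊤ : ℕ∞) fun x => σ x ξ) (l : List (Fin n)) (j : Fin n) (m : ℕ)
    (x : Fin n → ℝ) (ξ : Fin n → ℤ) :
    l.foldr pd (fun x' => (dd j)^[m] (σ x') ξ) x =
      (dd j)^[m] (fun ξ' => l.foldr pd (fun x' => σ x' ξ') x) ξ := by
  induction m generalizing σ with
  | zero => rfl
  | succ m ih =>
    have := ih (σ := fun x' => dd j (σ x')) fun ξ => (hσ _).sub (hσ _)
    simp only [Function.iterate_succ_apply]
    rw [this]
    refine congrFun (congrArg _ (funext fun ξ' => ?_)) ξ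
    exact congrFun (foldr_pd_sub (hσ (ξ' + Pi.single j 1)) (hσ ξ') l) x

lemma mIdxList_single (j : Fin n) (m : ℕ) : mIdxList (Pi.single j m) = List.replicate m j := by
  have h := mIdxList_count_perm (List.replicate m j)
  rw [List.perm_replicate] at h
  rw [← h]
  congr 1
  funext i
  rw [List.count_replicate]
  rcases eq_or_ne i j with rfl | hi
  · simp
  · simp [hi, hi.symm]

lemma ddM_single (j : Fin n) (m : ℕ) (g : (Fin n → ℤ) → ℂ) :
    ddM (Pi.single j m) g = (dd j)^[m] g := by
  rw [ddM, mIdxList_single]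
  induction m with
  | zero => rfl
  | succ m ih => rw [List.replicate_succ, List.foldr_cons, ih, Function.iterate_succ_apply']

lemma symbDxD_single {σ : (Fin n → ℝ) → (Fin n → ℤ) → ℂ}
    (hσ : ∀ ξ, ContDiff ℝ (⊤ : ℕ∞) fun x => σ x ξ) (β : Fin n → ℕ) (j : Fin n) (m : ℕ)
    (x : Fin n → ℝ) (ξ : Fin n → ℤ) :
    symbDxD β (Pi.single j m) σ x ξ =
      (dd j)^[m] (fun ξ' => pdM β (fun x' => σ x' ξ') x) ξ := by
  simp_rw [symbDxD, ddM_single]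
  exact foldr_pd_iterate_dd hσ _ j m x ξ

/-- The lattice points of the cube of radius `r`. -/
def latBox (n r : ℕ) : Finset (Fin n → ℤ) := Finset.Icc (fun _ => -(r : ℤ)) fun _ => (r : ℤ)

lemma mem_latBox {r : ℕ} {ξ : Fin n → ℤ} : ξ ∈ latBox n r ↔ ∀ i, |ξ i| ≤ r := by
  simp only [latBox, Finset.mem_Icc, Pi.le_def, abs_le, forall_and]

lemma card_latBox (n r : ℕ) : (latBox n r).card = (2 * r + 1) ^ n := by
  rw [latBox, Pi.card_Icc]
  simp only [Int.card_Icc, Finset.prod_const, Finset.card_univ, Fintype.card_fin]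
  congr 1
  omega

lemma iterate_dd_mul_dyCut_eq_zero {s : (Fin n → ℤ) → ℂ} {j : Fin n} {m N k : ℕ} (hm : m ≤ N)
    {ξ : Fin n → ℤ} (hξ : ξ ∉ latBox n (2 ^ (k + 1) + N)) :
    (dd j)^[m] (s * dyCut k) ξ = 0 := by
  refine iterate_dd_eq_zero j m fun q hq => ?_
  by_contra h
  refine hξ (mem_latBox.2 fun i => ?_)
  have h1 := abs_le_of_dyCut_ne_zero (right_ne_zero_of_mul h) i
  have h2 : |(ξ + q • Pi.single j 1 : Fin n → ℤ) i| ≤ 2 ^ (k + 1) := by exact_mod_cast h1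
  have h3 : |(q • Pi.single j (1 : ℤ) : Fin n → ℤ) i| ≤ N := by
    rcases eq_or_ne i j with rfl | hi
    · simp; omega
    · simp [Pi.single_eq_of_ne hi]
  have h4 : ξ i = (ξ + q • Pi.single j 1 : Fin n → ℤ) i - (q • Pi.single j (1 : ℤ) : Fin n → ℤ) i := by
    simp
  rw [h4]
  push_cast
  exact (abs_sub _ _).trans (add_le_add h2 h3)

lemma exists_integral_norm_trig_dyCut_le (hn : 1 ≤ n) {N : ℕ} (hN : n < 2 * N) {ε ρ C : ℝ}
    (hε : 0 ≤ ε) (hρ0 : 0 ≤ ρ) (hρ1 : ρ ≤ 1) (hC : 0 ≤ C)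
    {ω : ℝ → ℝ} (hω0 : ∀ t, 0 ≤ t → 0 ≤ ω t) (hω : MonotoneOn ω (Set.Ici (0 : ℝ))) :
    ∃ A : ℝ, 0 ≤ A ∧ ∀ s : (Fin n → ℤ) → ℂ,
      (∀ j i ξ, i ≤ N → ‖(dd j)^[i] s ξ‖ ≤
        C * ω (jb ξ ^ (-ε)) * jb ξ ^ (-((n : ℝ) / 2) * (1 - ρ) - ρ * i)) →
      ∀ k : ℕ, ∫ x, ‖trig (s * dyCut k) x‖ ∂(μT n) ≤
        A * (ω (((2 : ℝ) ^ k / 2 ^ (2 * N + 1)) ^ (-ε)) + (2⁻¹) ^ k) := by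
  choose M0 hM0 hM using exists_norm_iterate_dd_dyCut_le n
  obtain ⟨M, hMdef⟩ : ∃ M, M = ∑ l ∈ Finset.range (N + 1), M0 l := ⟨_, rfl⟩
  have hMle : ∀ l, l ≤ N → M0 l ≤ M := fun l hl => hMdef ▸
    Finset.single_le_sum (fun i _ => hM0 i) (Finset.mem_range.2 (by omega))
  have hMnn : 0 ≤ M := (hM0 0).trans (hMle 0 (by omega))
  obtain ⟨A1, hA1⟩ : ∃ A1 : ℝ, A1 = (2 ^ (2 * N + 1)) ^ ((n : ℝ) / 2 * (1 - ρ) + ρ * N) := ⟨_, rfl⟩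
  have hA1nn : 0 ≤ A1 := by rw [hA1]; positivity
  obtain ⟨B1, hB1⟩ : ∃ B1 : ℝ, B1 = 2 ^ N * (C * A1 * M) := ⟨_, rfl⟩
  have hB1nn : 0 ≤ B1 := by rw [hB1]; positivity
  have hn' : 1 ≤ (5 + 2 * N : ℝ) ^ n := one_le_pow₀ (by linarith [Nat.cast_nonneg (α := ℝ) N])
  have hker : 0 ≤ kerConst n N := by
    have : (1 : ℝ) < 2 * N / n := by
      rw [one_lt_div (by positivity)]; exact_mod_cast hN
    have : (0 : ℝ) < 2 * N / n - 1 := by linarith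
    rw [kerConst]; positivity
  refine ⟨kerConst n N * ((5 + 2 * N) ^ n * (B1 + 1)), by positivity, fun s hs k => ?_⟩
  obtain ⟨T, hT⟩ : ∃ T : ℝ, T = 2 ^ k / 2 ^ (2 * N + 1) := ⟨_, rfl⟩
  have hT0 : 0 < T := by rw [hT]; positivity
  have h2k : (1 : ℝ) ≤ 2 ^ k := one_le_pow₀ one_le_two
  obtain ⟨R, hR⟩ : ∃ R : ℝ, R = ((2 : ℝ) ^ k) ^ ρ := ⟨_, rfl⟩
  have hR0 : 0 < R := by rw [hR]; positivity
  have hRle : R ≤ 2 ^ k := by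
    rw [hR]; exact (Real.rpow_le_rpow_of_exponent_le h2k hρ1).trans_eq (Real.rpow_one _)
  obtain ⟨G, hG⟩ : ∃ G : ℝ, G = ((2 : ℝ) ^ k) ^ (-((n : ℝ) / 2 * (1 - ρ))) := ⟨_, rfl⟩
  have hG0 : 0 < G := by rw [hG]; positivity
  obtain ⟨w, hw⟩ : ∃ w : ℝ, w = ω (T ^ (-ε)) := ⟨_, rfl⟩
  have hw0 : 0 ≤ w := hw ▸ hω0 _ (by positivity)
  rw [← hT, ← hw]
  obtain ⟨v, hv⟩ : ∃ v : ℝ, v = w + 2⁻¹ ^ k := ⟨_, rfl⟩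
  have hwv : w ≤ v := by rw [hv]; exact le_add_of_nonneg_right (by positivity)
  have hv0 : 0 < v := by rw [hv]; positivity
  rw [← hv]
  have hsb : ∀ j i ξ, i ≤ N → T ≤ jb ξ → ‖(dd j)^[i] s ξ‖ ≤ C * v * (A1 * (G * (R⁻¹) ^ i)) := by
    intro j i ξ hi hTξ
    refine (hs j i ξ hi).trans ?_
    have hj : 0 < jb ξ := hT0.trans_le hTξ
    have e1 : ω (jb ξ ^ (-ε)) ≤ v := by
      refine le_trans ?_ hwv
      rw [hw]
      exact hω (Real.rpow_nonneg hj.le _) (Real.rpow_nonneg hT0.le _)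
        (Real.rpow_le_rpow_of_nonpos hT0 hTξ (by linarith))
    have e2 : jb ξ ^ (-((n : ℝ) / 2) * (1 - ρ) - ρ * i) ≤ A1 * (G * (R⁻¹) ^ i) := by
      have h0 : 0 ≤ (n : ℝ) / 2 * (1 - ρ) := mul_nonneg (by positivity) (by linarith)
      have h0' : 0 ≤ ρ * i := by positivity
      calc jb ξ ^ (-((n : ℝ) / 2) * (1 - ρ) - ρ * i)
          ≤ T ^ (-((n : ℝ) / 2) * (1 - ρ) - ρ * i) :=
            Real.rpow_le_rpow_of_nonpos hT0 hTξ (by linarith)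
        _ = (2 ^ (2 * N + 1)) ^ ((n : ℝ) / 2 * (1 - ρ) + ρ * i) * (G * (R⁻¹) ^ i) := by
            rw [hT, Real.div_rpow (by positivity) (by positivity), div_eq_mul_inv,
              ← Real.rpow_neg (by positivity), mul_comm, hG, hR]
            congr 1
            · congr 1; ring
            · rw [inv_pow, ← Real.rpow_natCast (((2 : ℝ) ^ k) ^ ρ), ← Real.rpow_mul (by positivity),
                ← Real.rpow_neg (by positivity), ← Real.rpow_add (by positivity)]
              congr 1; ring
        _ ≤ A1 * (G * (R⁻¹) ^ i) := by
            rw [hA1]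
            gcongr
            exact one_le_pow₀ one_le_two
    have e3 := hω0 (jb ξ ^ (-ε)) (by positivity)
    gcongr
  have hφ : ∀ (j : Fin n) l η, l ≤ N → ‖(dd j)^[l] (dyCut k) η‖ ≤ M * (R⁻¹) ^ l := by
    intro j l η hl
    refine (hM l j k η).trans ?_
    have := hMle l hl
    gcongr
  have hsφ : ∀ (j : Fin n) m ξ, m ≤ N →
      ‖(dd j)^[m] (s * dyCut k) ξ‖ ≤ B1 * v * G * (R⁻¹) ^ m := by
    intro j m ξ hm
    have hpos : 0 ≤ C * A1 * M * v * G * (R⁻¹) ^ m := by positivity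
    have key : ‖(dd j)^[m] (s * dyCut k) ξ‖ ≤ 2 ^ m * (C * A1 * M * v * G * (R⁻¹) ^ m) := by
      refine norm_iterate_dd_mul_le j m fun i l q hil hq => ?_
      by_cases hTξ : T ≤ jb ξ
      · calc _ ≤ (C * v * (A1 * (G * (R⁻¹) ^ i))) * (M * (R⁻¹) ^ l) :=
              mul_le_mul (hsb j i ξ (by omega) hTξ) (hφ j l _ (by omega)) (norm_nonneg _)
                (by positivity)
          _ = _ := by rw [← hil, pow_add]; ring
      · rw [iterate_dd_eq_zero j l (a := dyCut k), norm_zero, mul_zero]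
        · exact hpos
        · intro q' hq'
          by_contra h
          have h1 := le_jb_of_dyCut_ne_zero h
          rw [add_assoc, ← add_nsmul] at h1
          have h2 := jb_add_nsmul_single_le ξ j (q + q')
          have h3 : (2 : ℝ) ^ (q + q') ≤ 2 ^ (2 * N) := pow_le_pow_right₀ one_le_two (by omega)
          refine hTξ ?_
          rw [hT, div_le_iff₀ (by positivity)]
          have hj := one_le_jb ξ
          calc (2 : ℝ) ^ k ≤ 2 * (2 ^ (q + q') * jb ξ) := h1.trans (by linarith)
            _ ≤ 2 * (2 ^ (2 * N) * jb ξ) := by gcongr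
            _ = jb ξ * 2 ^ (2 * N + 1) := by ring
    refine key.trans ?_
    rw [hB1]
    calc (2 : ℝ) ^ m * (C * A1 * M * v * G * (R⁻¹) ^ m)
        ≤ 2 ^ N * (C * A1 * M * v * G * (R⁻¹) ^ m) := by
          gcongr
          exact one_le_two
      _ = _ := by ring
  have hGn : (2 ^ k : ℝ) ^ n * G ^ 2 = R ^ n := by
    rw [hG, hR, ← Real.rpow_natCast ((2 : ℝ) ^ k) n, ← Real.rpow_natCast (((2 : ℝ) ^ k) ^ ρ),
      ← Real.rpow_natCast (((2 : ℝ) ^ k) ^ (-((n : ℝ) / 2 * (1 - ρ)))) 2, ← Real.rpow_mul (by positivity), ← Real.rpow_mul (by positivity),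
      ← Real.rpow_add (by positivity)]
    congr 1
    push_cast
    ring
  rw [mul_assoc]
  refine integral_norm_trig_le hn hN hR0 (B := B1 * v * G) (by positivity)
    (S := latBox n (2 ^ (k + 1) + N))
    (fun ξ hξ => iterate_dd_mul_dyCut_eq_zero (j := ⟨0, hn⟩) (m := 0) (Nat.zero_le _) hξ)
    (fun j ξ hξ => iterate_dd_mul_dyCut_eq_zero le_rfl hξ)
    (fun ξ => by simpa using hsφ ⟨0, hn⟩ 0 ξ (Nat.zero_le _))
    (fun j ξ => ?_) ?_
  · refine (mul_le_mul_of_nonneg_right (hsφ j N ξ le_rfl) (by positivity)).trans_eq ?_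
    rw [mul_assoc, ← mul_pow, inv_mul_cancel₀ hR0.ne', one_pow, mul_one]
  · have hc : ((latBox n (2 ^ (k + 1) + N)).card : ℝ) ≤ (5 + 2 * N) ^ n * (2 ^ k) ^ n := by
      rw [card_latBox, ← mul_pow]
      push_cast
      gcongr
      rw [pow_succ]
      nlinarith [Nat.cast_nonneg (α := ℝ) N]
    calc _ ≤ (5 + 2 * N) ^ n * (2 ^ k) ^ n * (B1 * v * G) ^ 2 := by gcongr
      _ = (5 + 2 * N) ^ n * 1 * B1 ^ 2 * v ^ 2 * ((2 ^ k : ℝ) ^ n * G ^ 2) := by ring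
      _ ≤ (5 + 2 * N) ^ n * (5 + 2 * N) ^ n * (B1 + 1) ^ 2 * v ^ 2 * R ^ n := by
          rw [hGn]
          gcongr
          linarith
      _ = _ := by ring

end Dyadic

/-! ### Summability of the modulus over dyadic scales -/

lemma summable_comp_pow_of_integrableOn {ω : ℝ → ℝ} (hω0 : ∀ t, 0 ≤ t → 0 ≤ ω t)
    (hω : MonotoneOn ω (Set.Ici (0 : ℝ)))
    (hint : IntegrableOn (fun t => ω t * t⁻¹) (Set.Ioc (0 : ℝ) 1) volume)
    {q : ℝ} (hq0 : 0 < q) (hq1 : q < 1) : Summable fun m : ℕ => ω (q ^ (m + 1)) := by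
  have hsub : ∀ m : ℕ, Set.Ioc (q ^ (m + 1)) (q ^ m) ⊆ Set.Ioc (0 : ℝ) 1 := fun m t ht =>
    ⟨(pow_pos hq0 _).trans ht.1, ht.2.trans (pow_le_one₀ hq0.le hq1.le)⟩
  have hsum : Summable fun m : ℕ => ∫ t in Set.Ioc (q ^ (m + 1)) (q ^ m), ω t * t⁻¹ :=
    (hasSum_integral_iUnion (fun m => measurableSet_Ioc)
      (pow_right_anti₀ hq0.le hq1.le).pairwise_disjoint_on_Ioc_succ
      (hint.mono_set (Set.iUnion_subset hsub))).summable
  refine Summable.of_nonneg_of_le (fun m => hω0 _ (by positivity)) (fun m => ?_)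
    (hsum.mul_left (1 - q)⁻¹)
  have hqm : 0 < q ^ m := pow_pos hq0 m
  rw [inv_mul_eq_div, le_div_iff₀ (by linarith)]
  have hw := hω0 (q ^ (m + 1)) (by positivity)
  have key : ∫ t in Set.Ioc (q ^ (m + 1)) (q ^ m), ω (q ^ (m + 1)) * (q ^ m)⁻¹ ≤
      ∫ t in Set.Ioc (q ^ (m + 1)) (q ^ m), ω t * t⁻¹ := by
    refine setIntegral_mono_on (integrableOn_const (by simp)) (hint.mono_set (hsub m))
      measurableSet_Ioc fun t ht => ?_
    have ht0 : 0 < t := (pow_pos hq0 (m + 1)).trans ht.1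
    exact mul_le_mul (hω (Set.mem_Ici.2 (by positivity)) (Set.mem_Ici.2 ht0.le) ht.1.le)
      (inv_anti₀ ht0 ht.2) (by positivity) (hω0 t ht0.le)
  refine le_trans (le_of_eq ?_) key
  rw [setIntegral_const, Real.volume_real_Ioc_of_le (pow_le_pow_of_le_one hq0.le hq1.le (by omega)),
    smul_eq_mul, pow_succ]
  field_simp

lemma summable_comp_dyadic {ω : ℝ → ℝ} (hω0 : ∀ t, 0 ≤ t → 0 ≤ ω t)
    (hω : MonotoneOn ω (Set.Ici (0 : ℝ)))
    (hint : IntegrableOn (fun t => ω t * t⁻¹) (Set.Ioc (0 : ℝ) 1) volume)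
    {ε : ℝ} (hε : 0 < ε) (D : ℕ) :
    Summable fun k : ℕ => ω (((2 : ℝ) ^ k / 2 ^ D) ^ (-ε)) := by
  rw [← summable_nat_add_iff (D + 1)]
  refine (summable_comp_pow_of_integrableOn hω0 hω hint (q := 2 ^ (-ε)) (by positivity)
    (Real.rpow_lt_one_of_one_lt_of_neg one_lt_two (by linarith))).congr fun m => ?_
  congr 1
  rw [← Real.rpow_natCast (2 ^ (-ε)), ← Real.rpow_mul zero_le_two, mul_comm,
    Real.rpow_mul zero_le_two, Real.rpow_natCast]
  congr 1
  rw [_root_.eq_div_iff (by positivity), ← pow_add]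
  congr 1
  omega

/-! ### Operators with compactly supported symbols -/

section Pieces

variable {n : ℕ}

lemma pdM_sum_mul_symbol {σ : (Fin n → ℝ) → (Fin n → ℤ) → ℂ}
    (hσ : ∀ ξ, ContDiff ℝ (⊤ : ℕ∞) fun x => σ x ξ) {φ : (Fin n → ℤ) → ℂ}
    {S : Finset (Fin n → ℤ)} (hφ : ∀ ξ ∉ S, φ ξ = 0) (b : (Fin n → ℤ) → ℂ) (β : Fin n → ℕ)
    (x z : Fin n → ℝ) :
    pdM β (fun z => ∑ ξ ∈ S, eChar x ξ * φ ξ * b ξ * σ z ξ) z =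
      trig (fun ξ => ((fun ξ => pdM β (fun x' => σ x' ξ) z) * φ) ξ * b ξ) x := by
  rw [trig_eq_sum (S := S) fun ξ hξ => by simp [hφ ξ hξ]]
  have h := congrFun (foldr_pd_sum_mul S (fun ξ => eChar x ξ * φ ξ * b ξ)
    (u := fun ξ z => σ z ξ) hσ (mIdxList β)) z
  refine h.trans (Finset.sum_congr rfl fun ξ _ => ?_)
  simp only [pdM, Pi.mul_apply]
  ring

lemma lintegral_enorm_trig_symbol_rpow_le {m : ℕ} {p : ℝ} (hp : 1 ≤ p) {A : ℝ≥0∞}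
    (hA : ∀ u : (Fin n → ℝ) → ℂ, ContDiff ℝ (⊤ : ℕ∞) u → Per u → ∀ z,
      ‖u z‖ₑ ≤ A * (∫⁻ x, ENNReal.ofReal (sumPd m u x) ^ p ∂(μT n)) ^ (1 / p))
    {σ : (Fin n → ℝ) → (Fin n → ℤ) → ℂ}
    (hσ : ∀ ξ, ContDiff ℝ (⊤ : ℕ∞) fun x => σ x ξ) (hper : ∀ ξ, Per fun x => σ x ξ)
    {φ : (Fin n → ℤ) → ℂ} {S : Finset (Fin n → ℤ)} (hφ : ∀ ξ ∉ S, φ ξ = 0) {κ : ℝ≥0∞}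
    (hκ : ∀ β ∈ mIdxLe n m, ∀ z,
      ∫⁻ x, ‖trig ((fun ξ => pdM β (fun x' => σ x' ξ) z) * φ) x‖ₑ ∂(μT n) ≤ κ)
    {f : (Fin n → ℝ) → ℂ} (hf : Continuous f) :
    ∫⁻ x, ‖trig (fun ξ => σ x ξ * φ ξ * fc f ξ) x‖ₑ ^ p ∂(μT n) ≤
      (A * (mIdxLe n m).card * κ) ^ p * ∫⁻ x, ‖f x‖ₑ ^ p ∂(μT n) := by
  have hp0 : 0 < p := by linarith
  set d : ℝ≥0∞ := ((mIdxLe n m).card : ℝ≥0∞) with hd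
  set F := ∫⁻ x, ‖f x‖ₑ ^ p ∂(μT n)
  set E : (Fin n → ℕ) → (Fin n → ℝ) → (Fin n → ℝ) → ℝ≥0∞ := fun β x z =>
    ‖trig (fun ξ => ((fun ξ => pdM β (fun x' => σ x' ξ) z) * φ) ξ * fc f ξ) x‖ₑ ^ p with hE
  have hcont : ∀ β, Continuous fun q : (Fin n → ℝ) × (Fin n → ℝ) => E β q.1 q.2 := by
    intro β
    have h1 : ∀ q : (Fin n → ℝ) × (Fin n → ℝ), E β q.1 q.2 =
        ‖∑ ξ ∈ S, eChar q.1 ξ * (pdM β (fun x' => σ x' ξ) q.2 * φ ξ * fc f ξ)‖ₑ ^ p := fun q => by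
      simp only [hE]
      rw [trig_eq_sum (S := S) fun ξ hξ => by simp [hφ ξ hξ]]
      rfl
    have h2 : ∀ ξ, Continuous (pdM β (fun x' => σ x' ξ)) := fun ξ =>
      ((hσ ξ).foldr_pd (mIdxList β)).continuous
    rw [funext h1]
    have := ENNReal.continuous_rpow_const (y := p)
    fun_prop
  have hpt : ∀ x, ‖trig (fun ξ => σ x ξ * φ ξ * fc f ξ) x‖ₑ ^ p ≤
      A ^ p * d ^ (p - 1) * ∑ β ∈ mIdxLe n m, ∫⁻ z, E β x z ∂(μT n) := by
    intro x
    set u : (Fin n → ℝ) → ℂ := fun z => ∑ ξ ∈ S, eChar x ξ * φ ξ * fc f ξ * σ z ξ with hu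
    have hux : u x = trig (fun ξ => σ x ξ * φ ξ * fc f ξ) x := by
      rw [trig_eq_sum (S := S) fun ξ hξ => by simp [hφ ξ hξ]]
      exact Finset.sum_congr rfl fun ξ _ => by ring
    have hus : ContDiff ℝ (⊤ : ℕ∞) u :=
      ContDiff.sum fun ξ _ => contDiff_const.mul (hσ ξ)
    have hup : Per u := fun y v => Finset.sum_congr rfl fun ξ _ => by
      have := hper ξ y v
      simp only at this
      rw [this]
    have hsum : ∀ z, ENNReal.ofReal (sumPd m u z) ^ p ≤
        d ^ (p - 1) * ∑ β ∈ mIdxLe n m, E β x z := by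
      intro z
      rw [sumPd, ENNReal.ofReal_sum_of_nonneg fun _ _ => norm_nonneg _]
      refine (ENNReal.rpow_sum_le_const_mul_sum_rpow _ _ hp).trans_eq ?_
      congr 1
      refine Finset.sum_congr rfl fun β _ => ?_
      rw [ofReal_norm, hu, pdM_sum_mul_symbol hσ hφ]
    calc ‖trig (fun ξ => σ x ξ * φ ξ * fc f ξ) x‖ₑ ^ p
        ≤ (A * (∫⁻ z, ENNReal.ofReal (sumPd m u z) ^ p ∂(μT n)) ^ (1 / p)) ^ p := by
          gcongr
          rw [← hux]
          exact hA u hus hup x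
      _ = A ^ p * ∫⁻ z, ENNReal.ofReal (sumPd m u z) ^ p ∂(μT n) := by
          rw [ENNReal.mul_rpow_of_nonneg _ _ hp0.le, ← ENNReal.rpow_mul,
            one_div_mul_cancel hp0.ne', ENNReal.rpow_one]
      _ ≤ A ^ p * ∫⁻ z, d ^ (p - 1) * ∑ β ∈ mIdxLe n m, E β x z ∂(μT n) := by
          gcongr with z
          exact hsum z
      _ = _ := by
          have hm : ∀ β, Measurable fun z => E β x z := fun β =>
            ((hcont β).comp (Continuous.prodMk_right x)).measurable
          rw [lintegral_const_mul _ (Finset.measurable_fun_sum _ fun β _ => hm β),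
            lintegral_finsetSum _ fun β _ => hm β, mul_assoc]
  have hβ : ∀ β ∈ mIdxLe n m, ∫⁻ x, (∫⁻ z, E β x z ∂(μT n)) ∂(μT n) ≤ κ ^ p * F := by
    intro β hβ
    rw [lintegral_lintegral_swap (hcont β).measurable.aemeasurable]
    calc ∫⁻ z, (∫⁻ x, E β x z ∂(μT n)) ∂(μT n) ≤ ∫⁻ _, κ ^ p * F ∂(μT n) := by
          refine lintegral_mono fun z => ?_
          refine (lintegral_enorm_trig_mul_fc_rpow_le hp (S := S)
            (fun ξ hξ => by simp [hφ ξ hξ]) hf).trans ?_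
          gcongr
          exact hκ β hβ z
      _ = _ := by
          have := isProbabilityMeasure_μT n
          simp
  have hmeas : ∀ β, Measurable fun x => ∫⁻ z, E β x z ∂(μT n) := fun β =>
    (hcont β).measurable.lintegral_prod_right'
  calc ∫⁻ x, ‖trig (fun ξ => σ x ξ * φ ξ * fc f ξ) x‖ₑ ^ p ∂(μT n)
      ≤ ∫⁻ x, A ^ p * d ^ (p - 1) * ∑ β ∈ mIdxLe n m, ∫⁻ z, E β x z ∂(μT n) ∂(μT n) :=
        lintegral_mono hpt
    _ = A ^ p * d ^ (p - 1) * ∑ β ∈ mIdxLe n m, ∫⁻ x, (∫⁻ z, E β x z ∂(μT n)) ∂(μT n) := by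
        rw [lintegral_const_mul _ (Finset.measurable_fun_sum _ fun β _ => hmeas β),
          lintegral_finsetSum _ fun β _ => hmeas β]
    _ ≤ A ^ p * d ^ (p - 1) * (d * (κ ^ p * F)) := by
        gcongr
        refine (Finset.sum_le_card_nsmul _ _ _ hβ).trans_eq ?_
        rw [nsmul_eq_mul]
    _ = (A * d * κ) ^ p * F := by
        have h1 : d ^ (p - 1) * d = d ^ p := by
          nth_rw 2 [← ENNReal.rpow_one d]
          rw [← ENNReal.rpow_add_of_nonneg _ _ (by linarith) zero_le_one]
          congr 1
          ring
        rw [ENNReal.mul_rpow_of_nonneg _ _ hp0.le, ENNReal.mul_rpow_of_nonneg _ _ hp0.le, ← h1]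
        ring

end Pieces

/-! ### Summation over the dyadic pieces -/

section Summation

variable {n : ℕ}

lemma dyCut_eq_zero {k : ℕ} {ξ : Fin n → ℤ} (hξ : ξ ∉ latBox n (2 ^ (k + 1))) : dyCut k ξ = 0 := by
  rcases isEmpty_or_nonempty (Fin n) with h | h
  · exact absurd (mem_latBox.2 fun i => (IsEmpty.false i).elim) hξ
  · simpa using iterate_dd_mul_dyCut_eq_zero (s := 1) (j := Classical.arbitrary _) (m := 0)
      (N := 0) le_rfl hξ

lemma trig_mul_lowCut_mul_eq_sum (K : ℕ) (a b : (Fin n → ℤ) → ℂ) (x : Fin n → ℝ) :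
    trig (fun ξ => a ξ * lowCut K ξ * b ξ) x =
      ∑ k ∈ Finset.range K, trig (fun ξ => a ξ * dyCut k ξ * b ξ) x := by
  classical
  set S := (Finset.range K).biUnion fun k => latBox n (2 ^ (k + 1))
  have hS : ∀ k ∈ Finset.range K, ∀ ξ ∉ S, dyCut k ξ = 0 := fun k hk ξ hξ =>
    dyCut_eq_zero fun h => hξ (Finset.mem_biUnion.2 ⟨k, hk, h⟩)
  rw [trig_eq_sum (S := S) fun ξ hξ => by
    rw [← sum_dyCut, Finset.sum_eq_zero fun k hk => hS k hk ξ hξ, mul_zero, zero_mul],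
    Finset.sum_congr rfl fun k hk => trig_eq_sum (S := S) (fun ξ hξ => by
      rw [hS k hk ξ hξ, mul_zero, zero_mul]) x, Finset.sum_comm]
  refine Finset.sum_congr rfl fun ξ _ => ?_
  rw [← sum_dyCut, Finset.mul_sum, Finset.sum_mul, Finset.mul_sum]

lemma continuous_trig_symbol {σ : (Fin n → ℝ) → (Fin n → ℤ) → ℂ}
    (hσ : ∀ ξ, Continuous fun x => σ x ξ) (k : ℕ) (b : (Fin n → ℤ) → ℂ) :
    Continuous fun x => trig (fun ξ => σ x ξ * dyCut k ξ * b ξ) x := by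
  have h : ∀ x, trig (fun ξ => σ x ξ * dyCut k ξ * b ξ) x =
      ∑ ξ ∈ latBox n (2 ^ (k + 1)), eChar x ξ * (σ x ξ * dyCut k ξ * b ξ) := fun x =>
    trig_eq_sum (fun ξ hξ => by simp [dyCut_eq_zero hξ]) x
  simp_rw [h]
  fun_prop

lemma tendsto_trig_mul_lowCut {a b : (Fin n → ℤ) → ℂ} {x : Fin n → ℝ}
    (h : Summable fun ξ => eChar x ξ * a ξ * b ξ) :
    Filter.Tendsto (fun K => trig (fun ξ => a ξ * lowCut K ξ * b ξ) x) Filter.atTop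
      (nhds (∑' ξ, eChar x ξ * a ξ * b ξ)) := by
  refine tendsto_tsum_of_dominated_convergence h.norm (fun ξ => ?_)
    (Filter.Eventually.of_forall fun K ξ => ?_)
  · refine tendsto_const_nhds.congr' ?_
    obtain ⟨K, hK⟩ := pow_unbounded_of_one_lt (∑ i, |(ξ i : ℝ)|) one_lt_two
    filter_upwards [Filter.eventually_ge_atTop (K + 1)] with L hL
    obtain ⟨M, rfl⟩ := Nat.exists_eq_add_of_le' (Nat.le_of_add_left_le hL)
    rw [lowCut_eq_one fun i => ?_]
    · ring
    refine (Finset.single_le_sum (f := fun i => |(ξ i : ℝ)|) (fun _ _ => abs_nonneg _)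
      (Finset.mem_univ i)).trans (hK.le.trans ?_)
    exact pow_le_pow_right₀ one_le_two (by omega)
  · calc ‖eChar x ξ * (a ξ * lowCut K ξ * b ξ)‖
        = ‖lowCut K ξ‖ * ‖eChar x ξ * a ξ * b ξ‖ := by simp only [norm_mul]; ring
      _ ≤ _ := mul_le_of_le_one_left (norm_nonneg _) (norm_lowCut_le K ξ)

lemma lintegral_enorm_Op_rpow_le {p : ℝ} (hp : 1 ≤ p) {σ : (Fin n → ℝ) → (Fin n → ℤ) → ℂ}
    (hσ : ∀ ξ, Continuous fun x => σ x ξ) {f : (Fin n → ℝ) → ℂ} {v : ℕ → ℝ≥0∞}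
    (hv : ∀ k, eLpNorm' (fun x => trig (fun ξ => σ x ξ * dyCut k ξ * fc f ξ) x) p (μT n) ≤ v k) :
    ∫⁻ x, ‖Op σ f x‖ₑ ^ p ∂(μT n) ≤ (∑' k, v k) ^ p := by
  have hp0 : 0 < p := by linarith
  set T : ℕ → (Fin n → ℝ) → ℂ := fun k x => trig (fun ξ => σ x ξ * dyCut k ξ * fc f ξ) x
  have hT : ∀ k, Continuous (T k) := fun k => continuous_trig_symbol hσ k _
  have hsum : ∀ K, ∫⁻ x, ‖(∑ k ∈ Finset.range K, T k) x‖ₑ ^ p ∂(μT n) ≤ (∑' k, v k) ^ p := by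
    intro K
    have h := (eLpNorm'_sum_le (s := Finset.range K) (f := T) (μ := μT n)
      (fun k _ => (hT k).aestronglyMeasurable) hp).trans
        ((Finset.sum_le_sum fun k _ => hv k).trans (ENNReal.sum_le_tsum _))
    rw [eLpNorm'] at h
    calc _ = ((∫⁻ x, ‖(∑ k ∈ Finset.range K, T k) x‖ₑ ^ p ∂(μT n)) ^ (1 / p)) ^ p := by
          rw [← ENNReal.rpow_mul, one_div_mul_cancel hp0.ne', ENNReal.rpow_one]
      _ ≤ _ := by gcongr
  have hpt : ∀ x, ‖Op σ f x‖ₑ ^ p ≤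
      Filter.liminf (fun K => ‖(∑ k ∈ Finset.range K, T k) x‖ₑ ^ p) Filter.atTop := by
    intro x
    by_cases hs : Summable fun ξ => eChar x ξ * σ x ξ * fc f ξ
    · have h := ((ENNReal.continuous_rpow_const (y := p)).tendsto _).comp
        (tendsto_trig_mul_lowCut hs).enorm
      refine (h.liminf_eq.symm.trans ?_).le
      congr 1
      funext K
      simp only [Function.comp, trig_mul_lowCut_mul_eq_sum, Finset.sum_apply, T]
    · rw [Op, tsum_eq_zero_of_not_summable hs, enorm_zero, ENNReal.zero_rpow_of_pos hp0]
      exact zero_le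
  calc ∫⁻ x, ‖Op σ f x‖ₑ ^ p ∂(μT n)
      ≤ ∫⁻ x, Filter.liminf (fun K => ‖(∑ k ∈ Finset.range K, T k) x‖ₑ ^ p) Filter.atTop ∂(μT n) :=
        lintegral_mono hpt
    _ ≤ Filter.liminf (fun K => ∫⁻ x, ‖(∑ k ∈ Finset.range K, T k) x‖ₑ ^ p ∂(μT n))
          Filter.atTop := by
        refine lintegral_liminf_le fun K => ?_
        have : Continuous (∑ k ∈ Finset.range K, T k) := by
          rw [Finset.sum_fn]; fun_prop
        fun_prop
    _ ≤ (∑' k, v k) ^ p := by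
        refine (Filter.liminf_le_liminf (Filter.Eventually.of_forall hsum)).trans_eq ?_
        simp

lemma lpT_le_of_lintegral_le {p B : ℝ} (hp : 0 < p) (hB : 0 ≤ B) {g f : (Fin n → ℝ) → ℂ}
    (hf : Continuous f)
    (h : ∫⁻ x, ‖g x‖ₑ ^ p ∂(μT n) ≤ ENNReal.ofReal B ^ p * ∫⁻ x, ‖f x‖ₑ ^ p ∂(μT n)) :
    lpT n p g ≤ B * lpT n p f := by
  have hnorm : ∀ z : ℂ, ENNReal.ofReal (‖z‖ ^ p) = ‖z‖ₑ ^ p := fun z => by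
    rw [← ENNReal.ofReal_rpow_of_nonneg (norm_nonneg _) hp.le, ofReal_norm]
  have hfi : Integrable (fun x => ‖f x‖ ^ p) (μT n) :=
    integrable_μT_of_continuous (hf.norm.rpow_const fun _ => Or.inr hp.le)
  have hfe : ENNReal.ofReal (∫ x, ‖f x‖ ^ p ∂(μT n)) = ∫⁻ x, ‖f x‖ₑ ^ p ∂(μT n) := by
    rw [ofReal_integral_eq_lintegral_ofReal hfi
      (Filter.Eventually.of_forall fun x => by positivity)]
    simp_rw [hnorm]
  have hf0 : 0 ≤ ∫ x, ‖f x‖ ^ p ∂(μT n) := integral_nonneg fun x => by positivity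
  have hg0 : 0 ≤ ∫ x, ‖g x‖ ^ p ∂(μT n) := integral_nonneg fun x => by positivity
  have hle : ∫ x, ‖g x‖ ^ p ∂(μT n) ≤ B ^ p * ∫ x, ‖f x‖ ^ p ∂(μT n) := by
    rw [← ENNReal.ofReal_le_ofReal_iff (by positivity), ENNReal.ofReal_mul (by positivity), hfe,
      ← ENNReal.ofReal_rpow_of_nonneg hB hp.le]
    refine le_trans ?_ h
    have h1 := enorm_integral_le_lintegral_enorm (μ := μT n) fun x => ‖g x‖ ^ p
    rw [Real.enorm_of_nonneg hg0] at h1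
    refine h1.trans_eq (lintegral_congr fun x => ?_)
    rw [Real.enorm_of_nonneg (by positivity), hnorm]
  calc lpT n p g ≤ (B ^ p * ∫ x, ‖f x‖ ^ p ∂(μT n)) ^ (1 / p) :=
        Real.rpow_le_rpow hg0 hle (by positivity)
    _ = B * lpT n p f := by
        rw [Real.mul_rpow (by positivity) hf0, ← Real.rpow_mul hB, mul_one_div_cancel hp.ne',
          Real.rpow_one, lpT]

end Summation

/-- **Theorem IA.** Let `0 < ε ≤ 1`, `0 ≤ ρ ≤ 1`, `1 ≤ p < ∞` and let `ω` be non-decreasing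
and bounded on `[0,∞)` with `∫₀¹ ω(t)/t dt < ∞`.  If `σ : 𝕋ⁿ × ℤⁿ → ℂ` satisfies
`|∂_x^β Δ_ξ^α σ(x,ξ)| ≤ C ω(⟨ξ⟩^{-ε}) ⟨ξ⟩^{-(n/2)(1-ρ) - ρ|α|}` for `|α| ≤ [n/2]+1` and
`|β| ≤ [n/p]+1`, then `σ(x,D)` extends to a bounded operator on `L^p(𝕋ⁿ)`. -/
theorem periodic_pseudodiff_omega_Lp_bounded
    (n : ℕ) (hn : 1 ≤ n) (ε ρ p : ℝ)
    (hε0 : 0 < ε) (hε1 : ε ≤ 1) (hρ0 : 0 ≤ ρ) (hρ1 : ρ ≤ 1) (hp : 1 ≤ p)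
    (ω : ℝ → ℝ) (hω_nonneg : ∀ t, 0 ≤ t → 0 ≤ ω t)
    (hω_mono : MonotoneOn ω (Set.Ici (0 : ℝ)))
    (hω_bdd : ∃ M : ℝ, ∀ t, 0 ≤ t → ω t ≤ M)
    (hω_int : IntegrableOn (fun t => ω t * t⁻¹) (Set.Ioc (0 : ℝ) 1) volume)
    (σ : (Fin n → ℝ) → (Fin n → ℤ) → ℂ)
    (hσ_smooth : ∀ ξ, ContDiff ℝ (⊤ : ℕ∞) fun x => σ x ξ)
    (hσ_per : ∀ ξ, Per fun x => σ x ξ)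
    (C : ℝ) (hC : 0 < C)
    (hσ : ∀ (α β : Fin n → ℕ), (∑ j, α j) ≤ n / 2 + 1 → (∑ j, β j) ≤ ⌊(n : ℝ) / p⌋₊ + 1 →
      ∀ (x : Fin n → ℝ) (ξ : Fin n → ℤ),
        ‖symbDxD β α σ x ξ‖ ≤
          C * ω (jb ξ ^ (-ε)) * jb ξ ^ (-((n : ℝ) / 2) * (1 - ρ) - ρ * ∑ j, (α j : ℝ))) :
    ∃ C' : ℝ, 0 < C' ∧ ∀ f : (Fin n → ℝ) → ℂ, ContDiff ℝ (⊤ : ℕ∞) f → Per f →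
      lpT n p (Op σ f) ≤ C' * lpT n p f := by
  have hp0 : 0 < p := by linarith
  set N := n / 2 + 1 with hN
  set m := ⌊(n : ℝ) / p⌋₊ with hm
  obtain ⟨A, hA⟩ := exists_enorm_le_sobolev n m hp (Nat.lt_floor_add_one _)
  obtain ⟨A₂, hA₂, hker⟩ := exists_integral_norm_trig_dyCut_le hn (N := N) (by omega) hε0.le hρ0 hρ1
    hC.le hω_nonneg hω_mono
  set v : ℕ → ℝ := fun k => A₂ * (ω (((2 : ℝ) ^ k / 2 ^ (2 * N + 1)) ^ (-ε)) + (2⁻¹) ^ k) with hv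
  have hv0 : ∀ k, 0 ≤ v k := fun k =>
    mul_nonneg hA₂ (add_nonneg (hω_nonneg _ (by positivity)) (by positivity))
  have hvs : Summable v :=
    ((summable_comp_dyadic hω_nonneg hω_mono hω_int hε0 _).add
      (summable_geometric_of_lt_one (by norm_num) (by norm_num))).mul_left _
  have hsymb : ∀ β ∈ mIdxLe n (m + 1), ∀ z k,
      ∫⁻ x, ‖trig ((fun ξ => pdM β (fun x' => σ x' ξ) z) * dyCut k) x‖ₑ ∂(μT n) ≤
        ENNReal.ofReal (v k) := by
    intro β hβ z k
    rw [← ofReal_integral_norm_eq_lintegral_enorm (integrable_μT_of_continuous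
      (continuous_trig (S := latBox n (2 ^ (k + 1))) fun ξ hξ => by simp [dyCut_eq_zero hξ]))]
    refine ENNReal.ofReal_le_ofReal (hker _ (fun j i ξ hi => ?_) k)
    have h := hσ (Pi.single j i) β (by simpa using hi) (mem_mIdxLe.1 hβ) z ξ
    rw [symbDxD_single hσ_smooth, ← Nat.cast_sum, Finset.sum_pi_single'] at h
    simpa using h
  set D : ℝ := A * (mIdxLe n (m + 1)).card with hD
  have hD0 : 0 ≤ D := by positivity
  have hB0 : 0 ≤ D * ∑' k, v k := mul_nonneg hD0 (tsum_nonneg hv0)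
  refine ⟨D * ∑' k, v k + 1, by linarith, fun f hf _ => ?_⟩
  have hfc : Continuous f := hf.continuous
  set F := ∫⁻ x, ‖f x‖ₑ ^ p ∂(μT n) with hF
  have hpiece : ∀ k, eLpNorm' (fun x => trig (fun ξ => σ x ξ * dyCut k ξ * fc f ξ) x) p (μT n) ≤
      ENNReal.ofReal D * ENNReal.ofReal (v k) * F ^ (1 / p) := by
    intro k
    have h := lintegral_enorm_trig_symbol_rpow_le hp hA hσ_smooth hσ_per
      (S := latBox n (2 ^ (k + 1))) (fun ξ hξ => dyCut_eq_zero hξ) (fun β hβ z => hsymb β hβ z k) hfc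
    have hDe : (A : ℝ≥0∞) * (mIdxLe n (m + 1)).card = ENNReal.ofReal D := by
      rw [hD, ENNReal.ofReal_mul A.coe_nonneg, ENNReal.ofReal_coe_nnreal, ENNReal.ofReal_natCast]
    rw [hDe] at h
    refine (ENNReal.rpow_le_rpow h (by positivity : 0 ≤ 1 / p)).trans_eq ?_
    rw [ENNReal.mul_rpow_of_nonneg _ _ (by positivity), ← ENNReal.rpow_mul,
      mul_one_div_cancel hp0.ne', ENNReal.rpow_one]
  have hOp := lintegral_enorm_Op_rpow_le hp (fun ξ => (hσ_smooth ξ).continuous) hpiece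
  rw [ENNReal.tsum_mul_right, ENNReal.tsum_mul_left, ← ENNReal.ofReal_tsum_of_nonneg hv0 hvs,
    ← ENNReal.ofReal_mul hD0, ENNReal.mul_rpow_of_nonneg _ _ hp0.le, ← ENNReal.rpow_mul,
    one_div_mul_cancel hp0.ne', ENNReal.rpow_one] at hOp
  refine (lpT_le_of_lintegral_le hp0 hB0 hfc hOp).trans ?_
  have : 0 ≤ lpT n p f := Real.rpow_nonneg (integral_nonneg fun _ => by positivity) _
  nlinarith
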